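/- As R-modules, both the specialized affine algebra B̃C_{r,t} and the cyclotomic walled Brauer-Clifford superalgebra BC_{ℓ,r,t} are spanned by their regular monomials, i.e. by the elements x^α d x̄^β with d ∈ S and (α, β) ∈ ℕ^r × ℕ^t (for B̃C_{r,t}), respectively (α, β) ∈ {0,1,…,ℓ−1}^r × {0,1,…,ℓ−1}^t (for BC_{ℓ,r,t}). -/

import Mathlib

open Polynomial

noncomputable section

/-- Transposition `(a b)` (0-based indices) in the symmetric group on `Fin n`;
it is `1` if an index is out of range. -/
def sw (n a b : ℕ) : Equiv.Perm (Fin n) :=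
  if h : a < n ∧ b < n then Equiv.swap ⟨a, h.1⟩ ⟨b, h.2⟩ else 1

/-- The permutation word `s_{i,j}` of the paper (1-based indices):
`s_{i,j} = s_i s_{i+1,j}` for `i < j`, `s_{i,i} = 1`, `s_{i,j} = s_{i,j+1} s_j` for `i > j`. -/
def sIJ (n i j : ℕ) : Equiv.Perm (Fin n) :=
  if i < j then ((List.range' i (j - i)).map (fun k => sw n (k - 1) k)).prod
  else ((List.range' j (i - j)).reverse.map (fun k => sw n (k - 1) k)).prod

/-- The coefficients `a_{2n+1,j}` of the paper: `acoef ω n j = a_{2n+1,j}`, defined by the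
recursion `a_{1,0} = -1`, `a_{2n+1,j+1} = a_{2n-1,j}` and
`a_{2n+1,0} = ∑_{j=0}^{n-1} a_{2n-1,j} ω_{2j+1}`. -/
def acoef {A : Type} [Ring A] (ω : ℕ → A) : ℕ → ℕ → A
  | 0, _ => -1
  | n + 1, 0 => ∑ j ∈ Finset.range (n + 1), acoef ω n j * ω (2 * j + 1)
  | n + 1, j + 1 => acoef ω n j

/-- The parameters `ω̄_k` determined by the parameters `ω` as in Corollary 3.5:
`ω̄_{2n} = 0` and `ω̄_{2n+1} = ∑_{j=0}^{n} a_{2n+1,j} ω_{2j+1}`. -/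
def obar {R : Type} [CommRing R] (ω : ℕ → R) (k : ℕ) : R :=
  if k % 2 = 0 then 0
  else ∑ j ∈ Finset.range (k / 2 + 1), acoef ω (k / 2) j * ω (2 * j + 1)

/-- Data for the presentation of the walled Brauer–Clifford superalgebra `BC_{r,t}`
(Definition 2.1 together with relations (2.1)–(2.3)) on an `R`-algebra `A`.
The images of the two symmetric groups are recorded as monoid homomorphisms, so the
symmetric group relations among the `s_i` (resp. `s̄_j`) hold automatically. -/
structure WBC (R A : Type) [CommRing R] [Ring A] [Algebra R A] (r t : ℕ) : Type where
  σ : Equiv.Perm (Fin r) →* A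
  σb : Equiv.Perm (Fin t) →* A
  c : Fin r → A
  cb : Fin t → A
  e : A
  c_sq : ∀ i, c i * c i = -1
  c_anti : ∀ i j, i ≠ j → c i * c j = -(c j * c i)
  c_conj : ∀ w i, σ w * c i * σ (w⁻¹) = c (w i)
  cb_sq : ∀ i, cb i * cb i = 1
  cb_anti : ∀ i j, i ≠ j → cb i * cb j = -(cb j * cb i)
  cb_conj : ∀ w i, σb w * cb i * σb (w⁻¹) = cb (w i)
  comm_σσb : ∀ w v, σ w * σb v = σb v * σ w
  comm_σcb : ∀ w j, σ w * cb j = cb j * σ w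
  comm_σbc : ∀ v i, σb v * c i = c i * σb v
  anti_ccb : ∀ i j, c i * cb j = -(cb j * c i)
  e_c1 : ∀ (h1 : 0 < r) (h2 : 0 < t), e * c ⟨0, h1⟩ = e * cb ⟨0, h2⟩
  c1_e : ∀ (h1 : 0 < r) (h2 : 0 < t), c ⟨0, h1⟩ * e = cb ⟨0, h2⟩ * e
  e_sq : e * e = 0
  e_s_e : 1 < r → e * σ (sw r 0 1) * e = e
  e_sb_e : 1 < t → e * σb (sw t 0 1) * e = e
  s_e_comm : ∀ i : ℕ, 0 < i → i + 1 < r → σ (sw r i (i + 1)) * e = e * σ (sw r i (i + 1))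
  sb_e_comm : ∀ j : ℕ, 0 < j → j + 1 < t → σb (sw t j (j + 1)) * e = e * σb (sw t j (j + 1))
  braid1 : 1 < r → 1 < t →
    e * σ (sw r 0 1) * σb (sw t 0 1) * e * σ (sw r 0 1)
      = e * σ (sw r 0 1) * σb (sw t 0 1) * e * σb (sw t 0 1)
  braid2 : 1 < r → 1 < t →
    σ (sw r 0 1) * e * σ (sw r 0 1) * σb (sw t 0 1) * e
      = σb (sw t 0 1) * e * σ (sw r 0 1) * σb (sw t 0 1) * e
  c_e_comm : ∀ i : Fin r, (i : ℕ) ≠ 0 → c i * e = e * c i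
  cb_e_comm : ∀ j : Fin t, (j : ℕ) ≠ 0 → cb j * e = e * cb j
  e_c_e : ∀ h : 0 < r, e * c ⟨0, h⟩ * e = 0
  e_cb_e : ∀ h : 0 < t, e * cb ⟨0, h⟩ * e = 0

namespace WBC

variable {R A : Type} [CommRing R] [Ring A] [Algebra R A] {r t : ℕ}

/-- The transposition `(i,j) ∈ Σ_r` (1-based indices). -/
def tr (d : WBC R A r t) (i j : ℕ) : A := d.σ (sw r (i - 1) (j - 1))

/-- The transposition `(ī,j̄) ∈ Σ_t` (1-based indices). -/
def trb (d : WBC R A r t) (i j : ℕ) : A := d.σb (sw t (i - 1) (j - 1))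

/-- The generator `s_j = (j, j+1)` (1-based). -/
def s (d : WBC R A r t) (j : ℕ) : A := d.σ (sw r (j - 1) j)

/-- The generator `s̄_j` (1-based). -/
def sb (d : WBC R A r t) (j : ℕ) : A := d.σb (sw t (j - 1) j)

/-- The generator `c_i` (1-based). -/
def cn (d : WBC R A r t) (i : ℕ) : A := if h : i - 1 < r then d.c ⟨i - 1, h⟩ else 0

/-- The generator `c̄_i` (1-based). -/
def cbn (d : WBC R A r t) (i : ℕ) : A := if h : i - 1 < t then d.cb ⟨i - 1, h⟩ else 0

/-- `e_{i,j} = (1̄,j̄)(1,i) e_1 (1,i)(1̄,j̄)` (1-based). -/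
def E (d : WBC R A r t) (i j : ℕ) : A := d.trb 1 j * d.tr 1 i * d.e * d.tr 1 i * d.trb 1 j

/-- `ē_{i,j} = c_i e_{i,j} c_i`. -/
def Eb (d : WBC R A r t) (i j : ℕ) : A := d.cn i * d.E i j * d.cn i

/-- `L'_i = ∑_{j=1}^{i-1} (j,i)`. -/
def LL (d : WBC R A r t) (i : ℕ) : A := ∑ j ∈ Finset.Ico 1 i, d.tr j i

/-- The Jucys–Murphy element `L_i = L'_i + c_i L'_i c_i`. -/
def L (d : WBC R A r t) (i : ℕ) : A := d.LL i + d.cn i * d.LL i * d.cn i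

/-- `L̄'_i = ∑_{j=1}^{i-1} (j̄,ī)`. -/
def LLb (d : WBC R A r t) (i : ℕ) : A := ∑ j ∈ Finset.Ico 1 i, d.trb j i

/-- The Jucys–Murphy element `L̄_i = L̄'_i - c̄_i L̄'_i c̄_i`. -/
def Lb (d : WBC R A r t) (i : ℕ) : A := d.LLb i - d.cbn i * d.LLb i * d.cbn i

/-- `y_i = ∑_{j=1}^{i-1} (e_{i,j} + ē_{i,j}) - L_i`. -/
def y (d : WBC R A r t) (i : ℕ) : A := (∑ j ∈ Finset.Ico 1 i, (d.E i j + d.Eb i j)) - d.L i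

/-- `ȳ_i = ∑_{j=1}^{i-1} (e_{j,i} - ē_{j,i}) - L̄_i`. -/
def yb (d : WBC R A r t) (i : ℕ) : A := (∑ j ∈ Finset.Ico 1 i, (d.E j i - d.Eb j i)) - d.Lb i

/-- `c^α = c_1^{α_1} ⋯ c_r^{α_r}`. -/
def cpow (d : WBC R A r t) (α : Fin r → Fin 2) : A :=
  ((List.finRange r).map (fun i => d.c i ^ (α i : ℕ))).prod

/-- `c̄^β = c̄_1^{β_1} ⋯ c̄_t^{β_t}`. -/
def cbpow (d : WBC R A r t) (β : Fin t → Fin 2) : A :=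
  ((List.finRange t).map (fun j => d.cb j ^ (β j : ℕ))).prod

/-- `e^f = e_1 e_2 ⋯ e_f`. -/
def epow (d : WBC R A r t) (f : ℕ) : A :=
  ((List.range f).map (fun i => d.E (i + 1) (i + 1))).prod

/-- Generators of the subalgebra `BC_{m,m}`: the elements `e_1`, `s_1, …, s_{m-1}`,
`s̄_1, …, s̄_{m-1}`, `c_1` and `c̄_1` (interpreted as `∅` when `m = 0`). -/
def lowerGens (d : WBC R A r t) (m : ℕ) : Set A :=
  {x | (1 ≤ m ∧ x = d.e) ∨ (∃ j : ℕ, 1 ≤ j ∧ j + 1 ≤ m ∧ x = d.s j)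
    ∨ (∃ j : ℕ, 1 ≤ j ∧ j + 1 ≤ m ∧ x = d.sb j)
    ∨ (1 ≤ m ∧ x = d.cn 1) ∨ (1 ≤ m ∧ x = d.cbn 1)}

end WBC

/-- `φ` intertwines two sets of walled Brauer–Clifford data. -/
structure WBCHom {R A B : Type} [CommRing R] [Ring A] [Algebra R A] [Ring B] [Algebra R B]
    {r t : ℕ} (d : WBC R A r t) (d' : WBC R B r t) (φ : A →ₐ[R] B) : Prop where
  map_σ : ∀ w, φ (d.σ w) = d'.σ w
  map_σb : ∀ w, φ (d.σb w) = d'.σb w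
  map_c : ∀ i, φ (d.c i) = d'.c i
  map_cb : ∀ j, φ (d.cb j) = d'.cb j
  map_e : φ d.e = d'.e

/-- `A` (with the data `d`) *is* the walled Brauer–Clifford superalgebra `BC_{r,t}`:
it is initial among all algebras with such data. -/
def WBC.IsUniversal {R A : Type} [CommRing R] [Ring A] [Algebra R A] {r t : ℕ}
    (d : WBC R A r t) : Prop :=
  ∀ (B : Type) [Ring B] [Algebra R B], ∀ d' : WBC R B r t, ∃! φ : A →ₐ[R] B, WBCHom d d' φ

/-- An element of `D^f_{r,t}`: data `1 ≤ i_1 < ⋯ < i_f ≤ r` and `k ≤ j_k ≤ t`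
(all 1-based) describing `s_{f,i_f} s̄_{f,j_f} ⋯ s_{1,i_1} s̄_{1,j_1}`. -/
structure DElt (r t f : ℕ) : Type where
  a : Fin f → ℕ
  b : Fin f → ℕ
  ha_mono : StrictMono a
  ha_lb : ∀ k, 1 ≤ a k
  ha_ub : ∀ k, a k ≤ r
  hb_lb : ∀ k : Fin f, (k : ℕ) + 1 ≤ b k
  hb_ub : ∀ k, b k ≤ t

/-- The `Σ_r`-component `s_{f,i_f} ⋯ s_{1,i_1}` of the element of `D^f_{r,t}`. -/
def DElt.pr {r t f : ℕ} (x : DElt r t f) : Equiv.Perm (Fin r) :=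
  ((List.finRange f).reverse.map (fun (k : Fin f) => sIJ r ((k : ℕ) + 1) (x.a k))).prod

/-- The `Σ_t`-component `s̄_{f,j_f} ⋯ s̄_{1,j_1}` of the element of `D^f_{r,t}`. -/
def DElt.pt {r t f : ℕ} (x : DElt r t f) : Equiv.Perm (Fin t) :=
  ((List.finRange f).reverse.map (fun (k : Fin f) => sIJ t ((k : ℕ) + 1) (x.b k))).prod

/-- Index for the basis `{c^α d_1⁻¹ e^f w d_2 c̄^β}` of `BC_{r,t}`; the component
`w ∈ Σ_{r-f} × Σ_{t-f}` is a pair of permutations fixing `1, …, f` pointwise. -/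
structure BCIndex (r t : ℕ) : Type where
  α : Fin r → Fin 2
  β : Fin t → Fin 2
  f : ℕ
  hf : f ≤ min r t
  d1 : DElt r t f
  d2 : DElt r t f
  w : Equiv.Perm (Fin r)
  wb : Equiv.Perm (Fin t)
  hw : ∀ i : Fin r, (i : ℕ) < f → w i = i
  hwb : ∀ j : Fin t, (j : ℕ) < f → wb j = j

/-- The basis element `c^α d_1⁻¹ e^f w d_2 c̄^β` of Theorem 2.4. -/
def WBC.basElt {R A : Type} [CommRing R] [Ring A] [Algebra R A] {r t : ℕ}
    (d : WBC R A r t) (x : BCIndex r t) : A :=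
  d.cpow x.α * d.σ (x.d1.pr⁻¹) * d.σb (x.d1.pt⁻¹) * d.epow x.f *
    d.σ x.w * d.σb x.wb * d.σ x.d2.pr * d.σb x.d2.pt * d.cbpow x.β

/-- Data for the presentation of the affine walled Brauer–Clifford superalgebra
`BC^aff_{r,t}` (Definition 3.1) with distinguished parameter `ω_1 ∈ R`.
`om k` is `ω_k` (with `ω_1` the scalar `ω1` and `ω_{2k} = 0`), `omb k` is `ω̄_k`. -/
structure AWBC (R A : Type) [CommRing R] [Ring A] [Algebra R A] (r t : ℕ) (ω1 : R)
    extends WBC R A r t : Type where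
  x1 : A
  xb1 : A
  om : ℕ → A
  omb : ℕ → A
  om_one : om 1 = algebraMap R A ω1
  om_even : ∀ k, om (2 * k) = 0
  omb_zero : omb 0 = 0
  om_comm : ∀ k, (∀ w, om k * σ w = σ w * om k) ∧ (∀ w, om k * σb w = σb w * om k) ∧
    (∀ i, om k * c i = c i * om k) ∧ (∀ j, om k * cb j = cb j * om k) ∧
    om k * e = e * om k ∧ om k * x1 = x1 * om k ∧ om k * xb1 = xb1 * om k ∧
    (∀ l, om k * om l = om l * om k) ∧ (∀ l, om k * omb l = omb l * om k)
  omb_comm : ∀ k, (∀ w, omb k * σ w = σ w * omb k) ∧ (∀ w, omb k * σb w = σb w * omb k) ∧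
    (∀ i, omb k * c i = c i * omb k) ∧ (∀ j, omb k * cb j = cb j * omb k) ∧
    omb k * e = e * omb k ∧ omb k * x1 = x1 * omb k ∧ omb k * xb1 = xb1 * omb k ∧
    (∀ l, omb k * omb l = omb l * omb k)
  x_comm : ∀ h : 1 < r, x1 * (σ (sw r 0 1) * x1 * σ (sw r 0 1)
      - (1 - c ⟨0, by omega⟩ * c ⟨1, h⟩) * σ (sw r 0 1))
    = (σ (sw r 0 1) * x1 * σ (sw r 0 1)
      - (1 - c ⟨0, by omega⟩ * c ⟨1, h⟩) * σ (sw r 0 1)) * x1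
  x1_c1 : ∀ h : 0 < r, x1 * c ⟨0, h⟩ = -(c ⟨0, h⟩ * x1)
  x1_c : ∀ i : Fin r, (i : ℕ) ≠ 0 → x1 * c i = c i * x1
  s_x1 : ∀ i : ℕ, 0 < i → i + 1 < r → σ (sw r i (i + 1)) * x1 = x1 * σ (sw r i (i + 1))
  xb_comm : ∀ h : 1 < t, xb1 * (σb (sw t 0 1) * xb1 * σb (sw t 0 1)
      - (1 + cb ⟨0, by omega⟩ * cb ⟨1, h⟩) * σb (sw t 0 1))
    = (σb (sw t 0 1) * xb1 * σb (sw t 0 1)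
      - (1 + cb ⟨0, by omega⟩ * cb ⟨1, h⟩) * σb (sw t 0 1)) * xb1
  xb1_cb1 : ∀ h : 0 < t, xb1 * cb ⟨0, h⟩ = -(cb ⟨0, h⟩ * xb1)
  xb1_cb : ∀ j : Fin t, (j : ℕ) ≠ 0 → xb1 * cb j = cb j * xb1
  sb_xb1 : ∀ j : ℕ, 0 < j → j + 1 < t → σb (sw t j (j + 1)) * xb1 = xb1 * σb (sw t j (j + 1))
  e_xsum : e * (x1 + xb1) = 0
  xsum_e : (x1 + xb1) * e = 0
  e_sxs : 1 < r → e * (σ (sw r 0 1) * x1 * σ (sw r 0 1)) = (σ (sw r 0 1) * x1 * σ (sw r 0 1)) * e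
  x_mixed : ∀ h : 0 < r, x1 * (e + xb1 - c ⟨0, h⟩ * e * c ⟨0, h⟩)
      = (e - c ⟨0, h⟩ * e * c ⟨0, h⟩ + xb1) * x1
  e_sbxbsb : 1 < t →
    e * (σb (sw t 0 1) * xb1 * σb (sw t 0 1)) = (σb (sw t 0 1) * xb1 * σb (sw t 0 1)) * e
  e_xodd : ∀ k : ℕ, e * x1 ^ (2 * k + 1) * e = om (2 * k + 1) * e
  e_xeven : ∀ k : ℕ, 1 ≤ k → e * x1 ^ (2 * k) * e = 0
  e_xb : ∀ k : ℕ, 1 ≤ k → e * xb1 ^ k * e = omb k * e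
  x1_cb_comm : ∀ j, x1 * cb j = cb j * x1
  xb1_c_comm : ∀ i, xb1 * c i = c i * xb1
  x1_σb : ∀ w, σb w * x1 = x1 * σb w
  xb1_σ : ∀ w, σ w * xb1 = xb1 * σ w

namespace AWBC

variable {R A : Type} [CommRing R] [Ring A] [Algebra R A] {r t : ℕ} {ω1 : R}

/-- `x'_i = s_{i-1} ⋯ s_1 x_1 s_1 ⋯ s_{i-1}` (1-based). -/
def xp (d : AWBC R A r t ω1) (i : ℕ) : A :=
  ((List.range (i - 1)).reverse.map (fun k => d.toWBC.s (k + 1))).prod * d.x1 *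
    ((List.range (i - 1)).map (fun k => d.toWBC.s (k + 1))).prod

/-- `x̄'_j = s̄_{j-1} ⋯ s̄_1 x̄_1 s̄_1 ⋯ s̄_{j-1}` (1-based). -/
def xbp (d : AWBC R A r t ω1) (j : ℕ) : A :=
  ((List.range (j - 1)).reverse.map (fun k => d.toWBC.sb (k + 1))).prod * d.xb1 *
    ((List.range (j - 1)).map (fun k => d.toWBC.sb (k + 1))).prod

/-- `x_i = x'_i - L_i`. -/
def xv (d : AWBC R A r t ω1) (i : ℕ) : A := d.xp i - d.toWBC.L i

/-- `x̄_j = x̄'_j - L̄_j`. -/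
def xbv (d : AWBC R A r t ω1) (j : ℕ) : A := d.xbp j - d.toWBC.Lb j

/-- `x^α = x_1^{α_1} ⋯ x_r^{α_r}`. -/
def xpow (d : AWBC R A r t ω1) (α : Fin r → ℕ) : A :=
  ((List.finRange r).map (fun (i : Fin r) => d.xv ((i : ℕ) + 1) ^ α i)).prod

/-- `x̄^β = x̄_1^{β_1} ⋯ x̄_t^{β_t}`. -/
def xbpow (d : AWBC R A r t ω1) (β : Fin t → ℕ) : A :=
  ((List.finRange t).map (fun (j : Fin t) => d.xbv ((j : ℕ) + 1) ^ β j)).prod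

/-- `∏_{n ∈ ℤ^{>0}} ω_{2n+1}^{a_{2n+1}}`, where `g i` is the exponent of `ω_{2(i+1)+1}`. -/
def ompow (d : AWBC R A r t ω1) (g : ℕ →₀ ℕ) : A :=
  ((g.support.sort (· ≤ ·)).map (fun n => d.om (2 * n + 3) ^ g n)).prod

/-- `z_i = x'_i + y_i`. -/
def z (d : AWBC R A r t ω1) (i : ℕ) : A := d.xp i + d.toWBC.y i

/-- `z̄_j = x̄'_j + ȳ_j`. -/
def zb (d : AWBC R A r t ω1) (j : ℕ) : A := d.xbp j + d.toWBC.yb j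

/-- Generators of the subalgebra `BC_{2,m,m}`-type subalgebra:
`e_1, s_1, …, s_{m-1}, s̄_1, …, s̄_{m-1}, c_1, c̄_1, x_1, x̄_1`. -/
def lowerGensA (d : AWBC R A r t ω1) (m : ℕ) : Set A :=
  d.toWBC.lowerGens m ∪ {x | 1 ≤ m ∧ (x = d.x1 ∨ x = d.xb1)}

end AWBC

/-- `φ` intertwines two sets of affine walled Brauer–Clifford data. -/
structure AWBCHom {R A B : Type} [CommRing R] [Ring A] [Algebra R A] [Ring B] [Algebra R B]
    {r t : ℕ} {ω1 : R} (d : AWBC R A r t ω1) (d' : AWBC R B r t ω1) (φ : A →ₐ[R] B) : Prop where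
  map_σ : ∀ w, φ (d.σ w) = d'.σ w
  map_σb : ∀ w, φ (d.σb w) = d'.σb w
  map_c : ∀ i, φ (d.c i) = d'.c i
  map_cb : ∀ j, φ (d.cb j) = d'.cb j
  map_e : φ d.e = d'.e
  map_x1 : φ d.x1 = d'.x1
  map_xb1 : φ d.xb1 = d'.xb1
  map_om : ∀ k, φ (d.om k) = d'.om k
  map_omb : ∀ k, φ (d.omb k) = d'.omb k

/-- `A` (with the data `d`) is the affine walled Brauer–Clifford superalgebra
`BC^aff_{r,t}` of Definition 3.1. -/
def AWBC.IsUniversal {R A : Type} [CommRing R] [Ring A] [Algebra R A] {r t : ℕ} {ω1 : R}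
    (d : AWBC R A r t ω1) : Prop :=
  ∀ (B : Type) [Ring B] [Algebra R B], ∀ d' : AWBC R B r t ω1,
    ∃! φ : A →ₐ[R] B, AWBCHom d d' φ

/-- Assumption 3.6: the parameters `ω̄` are determined by the `ω`'s as in Corollary 3.5. -/
def AWBC.Ass36 {R A : Type} [CommRing R] [Ring A] [Algebra R A] {r t : ℕ} {ω1 : R}
    (d : AWBC R A r t ω1) : Prop :=
  (∀ n, d.omb (2 * n) = 0) ∧
  (∀ n, d.omb (2 * n + 1) = ∑ j ∈ Finset.range (n + 1), acoef d.om n j * d.om (2 * j + 1))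

/-- `A` (with the data `d`) is the affine walled Brauer–Clifford superalgebra
`BC^aff_{r,t}` subject to Assumption 3.6. -/
def AWBC.IsUniversal36 {R A : Type} [CommRing R] [Ring A] [Algebra R A] {r t : ℕ} {ω1 : R}
    (d : AWBC R A r t ω1) : Prop :=
  d.Ass36 ∧ ∀ (B : Type) [Ring B] [Algebra R B], ∀ d' : AWBC R B r t ω1,
    d'.Ass36 → ∃! φ : A →ₐ[R] B, AWBCHom d d' φ

/-- The parameters `ω_k`, `ω̄_k` are the scalars `ω k`, `obar ω k` (specialization defining
the algebra `B̃C_{r,t}` of Definition 3.13). -/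
def AWBC.IsSpec {R A : Type} [CommRing R] [Ring A] [Algebra R A] {r t : ℕ} {ω1 : R}
    (d : AWBC R A r t ω1) (ω : ℕ → R) : Prop :=
  (∀ k, d.om k = algebraMap R A (ω k)) ∧ (∀ k, 1 ≤ k → d.omb k = algebraMap R A (obar ω k))

/-- `A` (with the data `d`) is the algebra `B̃C_{r,t}` of Definition 3.13 with parameters
`ω_{2n+1} ∈ R`. -/
def AWBC.IsSpecUniversal {R A : Type} [CommRing R] [Ring A] [Algebra R A] {r t : ℕ} {ω1 : R}
    (d : AWBC R A r t ω1) (ω : ℕ → R) : Prop :=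
  d.IsSpec ω ∧ ∀ (B : Type) [Ring B] [Algebra R B], ∀ d' : AWBC R B r t ω1,
    d'.IsSpec ω → ∃! φ : A →ₐ[R] B, AWBCHom d d' φ

/-- The cyclotomic relations `f(x_1) = 0` and `g(x̄_1) = 0`. -/
def AWBC.IsCyc {R A : Type} [CommRing R] [Ring A] [Algebra R A] {r t : ℕ} {ω1 : R}
    (d : AWBC R A r t ω1) (f g : Polynomial R) : Prop :=
  Polynomial.aeval d.x1 f = 0 ∧ Polynomial.aeval d.xb1 g = 0

/-- `A` (with the data `d`) is the cyclotomic walled Brauer–Clifford superalgebra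
`BC_{ℓ,r,t}` of Definition 3.14 attached to `f`, `g` and the scalar parameters `ω`. -/
def AWBC.IsCycUniversal {R A : Type} [CommRing R] [Ring A] [Algebra R A] {r t : ℕ} {ω1 : R}
    (d : AWBC R A r t ω1) (ω : ℕ → R) (f g : Polynomial R) : Prop :=
  d.IsSpec ω ∧ d.IsCyc f g ∧ ∀ (B : Type) [Ring B] [Algebra R B], ∀ d' : AWBC R B r t ω1,
    d'.IsSpec ω → d'.IsCyc f g → ∃! φ : A →ₐ[R] B, AWBCHom d d' φ

/-- Index of a regular monomial `x^α d x̄^β ∏_{n≥1} ω_{2n+1}^{a_{2n+1}}` of `BC^aff_{r,t}`. -/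
structure ARIndex (r t : ℕ) : Type where
  α : Fin r → ℕ
  β : Fin t → ℕ
  dIdx : BCIndex r t
  g : ℕ →₀ ℕ

/-- The regular monomial `x^α d x̄^β ∏_{n≥1} ω_{2n+1}^{a_{2n+1}}` of Definition 3.11. -/
def AWBC.regElt {R A : Type} [CommRing R] [Ring A] [Algebra R A] {r t : ℕ} {ω1 : R}
    (d : AWBC R A r t ω1) (x : ARIndex r t) : A :=
  d.xpow x.α * d.toWBC.basElt x.dIdx * d.xbpow x.β * d.ompow x.g

/-- Index of a regular monomial `x^α d x̄^β` of `B̃C_{r,t}`. -/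
structure SIndex (r t : ℕ) : Type where
  α : Fin r → ℕ
  β : Fin t → ℕ
  dIdx : BCIndex r t

/-- The regular monomial `x^α d x̄^β` of `B̃C_{r,t}`. -/
def AWBC.sregElt {R A : Type} [CommRing R] [Ring A] [Algebra R A] {r t : ℕ} {ω1 : R}
    (d : AWBC R A r t ω1) (x : SIndex r t) : A :=
  d.xpow x.α * d.toWBC.basElt x.dIdx * d.xbpow x.β

/-- Index of a regular monomial `x^α d x̄^β` of the level `ℓ` algebra `BC_{ℓ,r,t}`,
with exponents in `{0, 1, …, ℓ-1}`. -/
structure CIndex (r t ℓ : ℕ) : Type where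
  α : Fin r → Fin ℓ
  β : Fin t → Fin ℓ
  dIdx : BCIndex r t

/-- The regular monomial `x^α d x̄^β` of `BC_{ℓ,r,t}`. -/
def AWBC.cregElt {R A : Type} [CommRing R] [Ring A] [Algebra R A] {r t ℓ : ℕ} {ω1 : R}
    (d : AWBC R A r t ω1) (x : CIndex r t ℓ) : A :=
  d.xpow (fun i => (x.α i : ℕ)) * d.toWBC.basElt x.dIdx * d.xbpow (fun j => (x.β j : ℕ))

/-- Admissibility (Definition 6.4): writing `f(x) = x^{k+2m} + ∑_{i=1}^{2m} a_i x^{k+2m-i}`,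
one has `ω_L = -(a_1 ω_{L-1} + ⋯ + a_{2m} ω_{L-2m})` for all `L ≥ k + 2m`. -/
def AdmissibleParam {R : Type} [CommRing R] (ω : ℕ → R) (f : Polynomial R) (k m : ℕ) : Prop :=
  ∀ L, k + 2 * m ≤ L →
    ω L = -∑ i ∈ Finset.Icc 1 (2 * m), f.coeff (k + 2 * m - i) * ω (L - i)

/-- The parameters `ω_0 = 0`, `ω_1 = -2m(2p-2m+1)`, `ω_i = p(p+1) ω_{i-2}` of (4.16). -/
def omSeq (m : ℕ) (p : ℂ) : ℕ → ℂ
  | 0 => 0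
  | 1 => -2 * (m : ℂ) * (2 * p - 2 * (m : ℂ) + 1)
  | n + 2 => p * (p + 1) * omSeq m p n

/-- Index of a monomial `d_1^{-1} c^α x'^β e^f x̄'^{β̄} c̄^{ᾱ} w d_2` of (4.20). -/
structure L2Index (r t : ℕ) : Type where
  α : Fin r → Fin 2
  βx : Fin r → Fin 2
  αb : Fin t → Fin 2
  βxb : Fin t → Fin 2
  f : ℕ
  hf : f ≤ min r t
  d1 : DElt r t f
  d2 : DElt r t f
  w : Equiv.Perm (Fin r)
  wb : Equiv.Perm (Fin t)
  hw : ∀ i : Fin r, (i : ℕ) < f → w i = i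
  hwb : ∀ j : Fin t, (j : ℕ) < f → wb j = j

/-- The monomial `d_1^{-1} c^α x'^β e^f x̄'^{β̄} c̄^{ᾱ} w d_2` of (4.20), where
`x'^β = x'_r{}^{β_r} ⋯ x'_1{}^{β_1}` and `x̄'^{β̄} = x̄'_t{}^{β̄_t} ⋯ x̄'_1{}^{β̄_1}`. -/
def AWBC.l2Elt {R A : Type} [CommRing R] [Ring A] [Algebra R A] {r t : ℕ} {ω1 : R}
    (d : AWBC R A r t ω1) (x : L2Index r t) : A :=
  d.toWBC.σ (x.d1.pr⁻¹) * d.toWBC.σb (x.d1.pt⁻¹) * d.toWBC.cpow x.α *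
    ((List.finRange r).reverse.map (fun (i : Fin r) => d.xp ((i : ℕ) + 1) ^ (x.βx i : ℕ))).prod *
    d.toWBC.epow x.f *
    ((List.finRange t).reverse.map (fun (j : Fin t) => d.xbp ((j : ℕ) + 1) ^ (x.βxb j : ℕ))).prod *
    d.toWBC.cbpow x.αb *
    d.toWBC.σ x.w * d.toWBC.σb x.wb * d.toWBC.σ x.d2.pr * d.toWBC.σb x.d2.pt


/-! ### Equality up to sign -/

/-- Equality up to sign. -/
def SE {B : Type} [Ring B] (a b : B) : Prop := a = b ∨ a = -b

namespace SE
variable {B : Type} [Ring B] {a b c d : B}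

theorem refl (a : B) : SE a a := Or.inl rfl
theorem of_eq (h : a = b) : SE a b := Or.inl h
theorem of_neg (h : a = -b) : SE a b := Or.inr h
theorem symm (h : SE a b) : SE b a := by
  rcases h with h | h
  · exact Or.inl h.symm
  · exact Or.inr (by rw [h, neg_neg])
theorem trans (h : SE a b) (h' : SE b c) : SE a c := by
  rcases h with h | h <;> rcases h' with h' | h'
  · exact Or.inl (h.trans h')
  · exact Or.inr (h.trans h')
  · exact Or.inr (by rw [h, h'])
  · exact Or.inl (by rw [h, h', neg_neg])
theorem mul (h : SE a b) (h' : SE c d) : SE (a * c) (b * d) := by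
  rcases h with h | h <;> rcases h' with h' | h' <;> subst h <;> subst h'
  · exact Or.inl rfl
  · exact Or.inr (by simp)
  · exact Or.inr (by simp)
  · exact Or.inl (by simp)
theorem mul_left (c : B) (h : SE a b) : SE (c * a) (c * b) := (refl c).mul h
theorem mul_right (c : B) (h : SE a b) : SE (a * c) (b * c) := h.mul (refl c)
theorem mem {R : Type} [CommRing R] [Algebra R B] {K : Submodule R B} (h : SE a b) (hb : b ∈ K) :
    a ∈ K := by
  rcases h with h | h <;> subst h
  · exact hb
  · exact K.neg_mem hb
theorem eq_zero (h : SE a b) (hb : b = 0) : a = 0 := by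
  subst hb; rcases h with h | h <;> simpa using h
/-- `a` commutes up to sign with `b * c`. -/
theorem comm_mul (h : SE (a * b) (b * a)) (h' : SE (a * c) (c * a)) :
    SE (a * (b * c)) (b * c * a) := by
  have h1 := h.mul_right c
  have h2 := h'.mul_left b
  simp only [mul_assoc] at *
  exact h1.trans h2
theorem comm_pow (h : SE (a * b) (b * a)) (n : ℕ) : SE (a * b ^ n) (b ^ n * a) := by
  induction n with
  | zero => simpa using refl a
  | succ n ih => rw [pow_succ]; exact ih.comm_mul h
theorem comm_list {ι : Type} (y : ι → B) (l : List ι) (h : ∀ i ∈ l, SE (a * y i) (y i * a)) :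
    SE (a * (l.map y).prod) ((l.map y).prod * a) := by
  induction l with
  | nil => simpa using refl a
  | cons i l ih =>
    rw [List.map_cons, List.prod_cons]
    exact (h i (by simp)).comm_mul (ih fun j hj => h j (by simp [hj]))
/-- inserting a letter into a sorted monomial -/
theorem insert_prod {ι : Type} [DecidableEq ι] (y : ι → B) (α β : ι → ℕ) (i : ι)
    (hc : ∀ j k, SE (y j * y k) (y k * y j))
    (hi : SE (y i * y i ^ α i) (y i ^ β i)) (hβ : ∀ j, j ≠ i → β j = α j)
    (l : List ι) (hl : l.Nodup) (hil : i ∈ l) :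
    SE (y i * (l.map (fun j => y j ^ α j)).prod) (l.map (fun j => y j ^ β j)).prod := by
  induction l with
  | nil => simp at hil
  | cons j l ih =>
    rw [List.nodup_cons] at hl
    simp only [List.map_cons, List.prod_cons]
    by_cases hij : i = j
    · subst hij
      rw [← mul_assoc]
      have : (l.map (fun j => y j ^ α j)) = (l.map (fun j => y j ^ β j)) := by
        apply List.map_congr_left
        intro k hk
        rw [hβ k (by rintro rfl; exact hl.1 hk)]
      rw [this]
      exact hi.mul_right _
    · have hm : i ∈ l := by simpa [hij] using hil
      have h1 := ((hc i j).comm_pow (α j)).mul_right (l.map (fun j => y j ^ α j)).prod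
      have h2 := (ih hl.2 hm).mul_left (y j ^ α j)
      rw [hβ j (fun h => hij h.symm)]
      simp only [mul_assoc] at h1 h2 ⊢
      exact h1.trans h2
end SE

/-! ### Permutation lemmas -/

theorem sw_eq {n : ℕ} (a b : ℕ) (ha : a < n) (hb : b < n) :
    sw n a b = Equiv.swap ⟨a, ha⟩ ⟨b, hb⟩ := by
  rw [sw, dif_pos ⟨ha, hb⟩]

theorem perm_fix_induction {n : ℕ} (P : Submonoid (Equiv.Perm (Fin (n + 1))))
    (h : ∀ i : ℕ, 0 < i → i + 1 < n + 1 → sw (n + 1) i (i + 1) ∈ P)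
    (w : Equiv.Perm (Fin (n + 1))) (hw : w 0 = 0) : w ∈ P := by
  obtain ⟨⟨p, v⟩, rfl⟩ := Equiv.Perm.decomposeFin.symm.surjective w
  rw [Equiv.Perm.decomposeFin_symm_apply_zero] at hw
  subst hw
  have hmul : ∀ a b : Equiv.Perm (Fin n), Equiv.Perm.decomposeFin.symm (0, a * b)
      = Equiv.Perm.decomposeFin.symm (0, a) * Equiv.Perm.decomposeFin.symm (0, b) := by
    intro a b
    ext x
    refine Fin.cases ?_ (fun x => ?_) x
    · simp
    · simp
  have hone : Equiv.Perm.decomposeFin.symm (0, (1 : Equiv.Perm (Fin n))) = 1 := by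
    rw [Equiv.Perm.decomposeFin_symm_of_one, Equiv.swap_self]; rfl
  cases n with
  | zero =>
    have : v = 1 := Subsingleton.elim _ _
    rw [this, hone]; exact P.one_mem
  | succ n =>
    have hv : v ∈ Submonoid.closure (Set.range fun i : Fin n => Equiv.swap i.castSucc i.succ) := by
      rw [Equiv.Perm.mclosure_swap_castSucc_succ]; trivial
    induction hv using Submonoid.closure_induction with
    | mem x hx =>
      obtain ⟨i, rfl⟩ := hx
      have := h (i + 1) (by omega) (by omega)
      convert this using 1
      rw [sw_eq _ _ (by omega) (by omega)]
      ext x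
      refine Fin.cases ?_ (fun x => ?_) x
      · rw [Equiv.Perm.decomposeFin_symm_apply_zero, Equiv.swap_apply_of_ne_of_ne] <;>
          simp [Fin.ext_iff]
      · rw [Equiv.Perm.decomposeFin_symm_apply_succ]
        simp only [Equiv.swap_self, Equiv.refl_apply]
        simp [Equiv.swap_apply_def, Fin.ext_iff]
        split_ifs <;> simp_all
    | one => rw [hone]; exact P.one_mem
    | mul a b _ _ ha hb => rw [hmul]; exact P.mul_mem ha hb

theorem exists_perm_one {n : ℕ} (h1 : 1 < n + 1) (i : Fin (n + 1)) (hi : i ≠ 0) :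
    ∃ w : Equiv.Perm (Fin (n + 1)), w 0 = 0 ∧ w ⟨1, h1⟩ = i := by
  refine ⟨Equiv.swap ⟨1, h1⟩ i, ?_, by simp⟩
  rw [Equiv.swap_apply_of_ne_of_ne]
  · simp [Fin.ext_iff]
  · exact hi.symm

theorem exists_perm_two {n : ℕ} (h1 : 1 < n + 1) (i k : Fin (n + 1)) (hi : i ≠ k) :
    ∃ w : Equiv.Perm (Fin (n + 1)), w 0 = i ∧ w ⟨1, h1⟩ = k := by
  obtain ⟨w, hw0, hw1⟩ := exists_perm_one h1 (Equiv.swap 0 i k) (by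
    intro h
    apply hi
    have := congrArg (Equiv.swap 0 i) h
    simpa using this.symm)
  refine ⟨Equiv.swap 0 i * w, by simp [hw0], by simp [hw1]⟩

section onesided
variable {B : Type} [Ring B] {n : ℕ} (σ : Equiv.Perm (Fin (n + 1)) →* B)

theorem stab_comm (e : B)
    (h : ∀ i : ℕ, 0 < i → i + 1 < n + 1 →
      σ (sw (n + 1) i (i + 1)) * e = e * σ (sw (n + 1) i (i + 1)))
    (w : Equiv.Perm (Fin (n + 1))) (hw : w 0 = 0) : σ w * e = e * σ w := by
  let P : Submonoid (Equiv.Perm (Fin (n + 1))) :=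
    { carrier := {w | σ w * e = e * σ w}
      one_mem' := by simp
      mul_mem' := by
        intro a b ha hb
        simp only [Set.mem_ofPred_eq, map_mul] at *
        rw [mul_assoc, hb, ← mul_assoc, ha, mul_assoc] }
  exact perm_fix_induction P h w hw

theorem perm_mul_inv (w : Equiv.Perm (Fin (n + 1))) : σ w * σ w⁻¹ = 1 := by
  rw [← map_mul]; simp

theorem perm_inv_mul (w : Equiv.Perm (Fin (n + 1))) : σ w⁻¹ * σ w = 1 := by
  rw [← map_mul]; simp

/-- conjugates of `y` -/
def cj (y : B) (i : Fin (n + 1)) : B := σ (Equiv.swap 0 i) * y * σ (Equiv.swap 0 i)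

theorem cj_zero (y : B) : cj σ y 0 = y := by
  have : σ (Equiv.swap 0 0) = 1 := by rw [Equiv.swap_self]; exact map_one σ
  rw [cj, this]; simp

theorem cj_of (y : B) (h : ∀ w : Equiv.Perm (Fin (n + 1)), w 0 = 0 → σ w * y = y * σ w)
    (w : Equiv.Perm (Fin (n + 1))) : σ w * y = cj σ y (w 0) * σ w := by
  have h1 := h (Equiv.swap 0 (w 0) * w) (by simp)
  rw [cj, mul_assoc, ← map_mul, mul_assoc, ← h1, ← mul_assoc, ← map_mul, ← mul_assoc]
  simp

theorem cj_move (y : B) (h : ∀ w : Equiv.Perm (Fin (n + 1)), w 0 = 0 → σ w * y = y * σ w)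
    (w : Equiv.Perm (Fin (n + 1))) (i : Fin (n + 1)) :
    σ w * cj σ y i = cj σ y (w i) * σ w := by
  have h1 := cj_of σ y h (w * Equiv.swap 0 i)
  rw [cj, ← mul_assoc, ← mul_assoc, ← map_mul, h1, mul_assoc, ← map_mul]
  simp [mul_assoc]

end onesided

/-! ### Graded data -/

/-- The relations satisfied in the associated graded algebra. -/
structure GData (R B : Type) [CommRing R] [Ring B] [Algebra R B] (r t : ℕ) : Type
    extends WBC R B (r + 1) (t + 1) where
  x1 : B
  xb1 : B
  x_comm : 1 < r + 1 → x1 * (σ (sw (r + 1) 0 1) * x1 * σ (sw (r + 1) 0 1))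
    = (σ (sw (r + 1) 0 1) * x1 * σ (sw (r + 1) 0 1)) * x1
  x1_c1 : x1 * c 0 = -(c 0 * x1)
  x1_c : ∀ i, i ≠ 0 → x1 * c i = c i * x1
  s_x1 : ∀ i : ℕ, 0 < i → i + 1 < r + 1 →
    σ (sw (r + 1) i (i + 1)) * x1 = x1 * σ (sw (r + 1) i (i + 1))
  xb_comm : 1 < t + 1 → xb1 * (σb (sw (t + 1) 0 1) * xb1 * σb (sw (t + 1) 0 1))
    = (σb (sw (t + 1) 0 1) * xb1 * σb (sw (t + 1) 0 1)) * xb1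
  xb1_cb1 : xb1 * cb 0 = -(cb 0 * xb1)
  xb1_cb : ∀ i, i ≠ 0 → xb1 * cb i = cb i * xb1
  sb_xb1 : ∀ i : ℕ, 0 < i → i + 1 < t + 1 →
    σb (sw (t + 1) i (i + 1)) * xb1 = xb1 * σb (sw (t + 1) i (i + 1))
  e_xsum : e * (x1 + xb1) = 0
  xsum_e : (x1 + xb1) * e = 0
  e_sxs : 1 < r + 1 → e * (σ (sw (r + 1) 0 1) * x1 * σ (sw (r + 1) 0 1))
    = (σ (sw (r + 1) 0 1) * x1 * σ (sw (r + 1) 0 1)) * e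
  x_xb : x1 * xb1 = xb1 * x1
  e_sbxbsb : 1 < t + 1 → e * (σb (sw (t + 1) 0 1) * xb1 * σb (sw (t + 1) 0 1))
    = (σb (sw (t + 1) 0 1) * xb1 * σb (sw (t + 1) 0 1)) * e
  e_xpow : ∀ k : ℕ, e * x1 ^ k * e = 0
  x1_cb_comm : ∀ j, x1 * cb j = cb j * x1
  xb1_c_comm : ∀ i, xb1 * c i = c i * xb1
  x1_σb : ∀ w, σb w * x1 = x1 * σb w
  xb1_σ : ∀ w, σ w * xb1 = xb1 * σ w

namespace GData
variable {R B : Type} [CommRing R] [Ring B] [Algebra R B] {r t : ℕ} (d : GData R B r t)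

/-- The group `Σ_r × Σ_t`. -/
abbrev Gp (r t : ℕ) : Type := Equiv.Perm (Fin (r + 1)) × Equiv.Perm (Fin (t + 1))

/-- The vertices. -/
abbrev Vx (r t : ℕ) : Type := Fin (r + 1) ⊕ Fin (t + 1)

/-- action of the group on vertices -/
def act (g : Gp r t) (v : Vx r t) : Vx r t := Sum.map g.1 g.2 v

@[simp] theorem act_inl (g : Gp r t) (i) : act g (Sum.inl i) = Sum.inl (g.1 i) := rfl
@[simp] theorem act_inr (g : Gp r t) (i) : act g (Sum.inr i) = Sum.inr (g.2 i) := rfl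

/-- the representation of the group in the algebra -/
def ρ : Gp r t →* B where
  toFun g := d.σ g.1 * d.σb g.2
  map_one' := by simp
  map_mul' g h := by
    simp only [Prod.fst_mul, Prod.snd_mul, map_mul]
    rw [mul_assoc, mul_assoc, ← mul_assoc (d.σ h.1), d.comm_σσb, mul_assoc]

theorem ρ_def (g : Gp r t) : d.ρ g = d.σ g.1 * d.σb g.2 := rfl

theorem ρ_inl (w) : d.ρ (w, 1) = d.σ w := by simp [ρ_def]
theorem ρ_inr (w) : d.ρ (1, w) = d.σb w := by simp [ρ_def]

theorem ρ_mul_inv (g : Gp r t) : d.ρ g * d.ρ g⁻¹ = 1 := by rw [← map_mul]; simp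
theorem ρ_inv_mul (g : Gp r t) : d.ρ g⁻¹ * d.ρ g = 1 := by rw [← map_mul]; simp

theorem ρ_cancel (g : Gp r t) {a b : B} (h : a * d.ρ g = b * d.ρ g) : a = b := by
  have := congrArg (· * d.ρ g⁻¹) h
  simpa [mul_assoc, ρ_mul_inv] using this

theorem semi_eq (g : Gp r t) {a b a' b' : B} (ha : SemiconjBy (d.ρ g) a a')
    (hb : SemiconjBy (d.ρ g) b b') (h : a = b) : a' = b' := by
  subst h
  exact d.ρ_cancel g (ha.symm.trans hb)

theorem semi_SE (g : Gp r t) {a b a' b' : B} (ha : SemiconjBy (d.ρ g) a a')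
    (hb : SemiconjBy (d.ρ g) b b') (h : SE a b) : SE a' b' := by
  rcases h with h | h
  · exact Or.inl (d.semi_eq g ha hb h)
  · exact Or.inr (d.semi_eq g ha hb.neg_right h)

theorem semi_ρ (g h : Gp r t) : SemiconjBy (d.ρ g) (d.ρ h) (d.ρ (g * h * g⁻¹)) := by
  rw [SemiconjBy, ← map_mul, ← map_mul]; simp

/-- Letters: `x` for `false`, `c` for `true`. -/
def Lt : Bool → Vx r t → B
  | false, Sum.inl i => cj d.σ d.x1 i
  | false, Sum.inr i => cj d.σb d.xb1 i
  | true, Sum.inl i => d.c i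
  | true, Sum.inr i => d.cb i

theorem x1_stab (w : Equiv.Perm (Fin (r + 1))) (hw : w 0 = 0) : d.σ w * d.x1 = d.x1 * d.σ w :=
  stab_comm d.σ d.x1 d.s_x1 w hw
theorem xb1_stab (w : Equiv.Perm (Fin (t + 1))) (hw : w 0 = 0) :
    d.σb w * d.xb1 = d.xb1 * d.σb w :=
  stab_comm d.σb d.xb1 d.sb_xb1 w hw
theorem e_stab (w : Equiv.Perm (Fin (r + 1))) (hw : w 0 = 0) : d.σ w * d.e = d.e * d.σ w :=
  stab_comm d.σ d.e d.s_e_comm w hw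
theorem e_stabb (w : Equiv.Perm (Fin (t + 1))) (hw : w 0 = 0) :
    d.σb w * d.e = d.e * d.σb w :=
  stab_comm d.σb d.e d.sb_e_comm w hw

theorem semi_of {g : Gp r t} {a b c : B} (h1 : d.σ g.1 * a = b * d.σ g.1)
    (h2 : d.σb g.2 * c = a * d.σb g.2) : SemiconjBy (d.ρ g) c b := by
  rw [SemiconjBy, ρ_def, mul_assoc, h2, ← mul_assoc, h1, mul_assoc]

theorem cj_comm {n m : ℕ} (σ : Equiv.Perm (Fin (n + 1)) →* B) (σ' : Equiv.Perm (Fin (m + 1)) →* B)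
    (hc : ∀ w v, σ w * σ' v = σ' v * σ w) (y : B) (hy : ∀ v, σ' v * y = y * σ' v) (i) (v) :
    σ' v * cj σ y i = cj σ y i * σ' v := by
  rw [cj, ← mul_assoc, ← mul_assoc, ← hc, mul_assoc _ _ y, hy, mul_assoc _ _ (σ' v), hc]
  simp only [mul_assoc]

theorem semi_Lt (g : Gp r t) (b : Bool) (v : Vx r t) :
    SemiconjBy (d.ρ g) (d.Lt b v) (d.Lt b (act g v)) := by
  cases b <;> cases v
  · exact d.semi_of (cj_move _ _ d.x1_stab _ _) (cj_comm _ _ d.comm_σσb _ d.x1_σb _ _)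
  · refine d.semi_of ?_ (cj_move _ _ d.xb1_stab _ _)
    exact (cj_comm _ _ (fun w v => (d.comm_σσb v w).symm) _ d.xb1_σ _ _)
  · refine d.semi_of (a := d.c _) ?_ (d.comm_σbc _ _)
    have := d.c_conj g.1
    simp only [act_inl, Lt]
    rw [← this, mul_assoc, perm_inv_mul, mul_one]
  · refine d.semi_of (d.comm_σcb _ _) ?_
    have := d.cb_conj g.2
    simp only [Lt]
    rw [← this, mul_assoc, perm_inv_mul, mul_one]

/-- `e_{i,j}`, zero-based. -/
def EE (i : Fin (r + 1)) (j : Fin (t + 1)) : B := cj d.σb (cj d.σ d.e i) j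

theorem EE_zero : d.EE 0 0 = d.e := by rw [EE, cj_zero, cj_zero]

theorem semi_EE (g : Gp r t) (i j) : SemiconjBy (d.ρ g) (d.EE i j) (d.EE (g.1 i) (g.2 j)) := by
  refine d.semi_of (a := d.EE i (g.2 j)) ?_ ?_
  · have h1 := cj_move d.σ d.e d.e_stab g.1 i
    have h2 := d.comm_σσb g.1 (Equiv.swap 0 (g.2 j))
    rw [EE, EE, show ∀ y, cj d.σb y (g.2 j) = d.σb (Equiv.swap 0 (g.2 j)) * y
      * d.σb (Equiv.swap 0 (g.2 j)) from fun y => rfl, show ∀ y, cj d.σb y (g.2 j) =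
        d.σb (Equiv.swap 0 (g.2 j)) * y * d.σb (Equiv.swap 0 (g.2 j)) from fun y => rfl]
    rw [← mul_assoc, ← mul_assoc, h2, mul_assoc _ (d.σ g.1), h1, mul_assoc, mul_assoc, mul_assoc,
      h2]
    simp only [mul_assoc]
  · refine cj_move _ _ ?_ _ _
    intro v hv
    have h1 := d.e_stabb v hv
    rw [cj, ← mul_assoc, ← mul_assoc, ← d.comm_σσb, mul_assoc _ _ d.e, h1, mul_assoc, mul_assoc,
      ← d.comm_σσb]
    simp only [mul_assoc]

theorem sw01 (n : ℕ) (h : 1 < n + 1) : sw (n + 1) 0 1 = Equiv.swap 0 ⟨1, h⟩ := by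
  rw [sw_eq 0 1 (by omega) h]; rfl

theorem Lt_comm (b b' : Bool) (v v' : Vx r t) :
    SE (d.Lt b v * d.Lt b' v') (d.Lt b' v' * d.Lt b v) := by
  have key : ∀ (g : Gp r t) b b' v v', SE (d.Lt b v * d.Lt b' v') (d.Lt b' v' * d.Lt b v) →
      SE (d.Lt b (act g v) * d.Lt b' (act g v')) (d.Lt b' (act g v') * d.Lt b (act g v)) :=
    fun g b b' v v' h => d.semi_SE g ((d.semi_Lt g b v).mul_right (d.semi_Lt g b' v'))
      ((d.semi_Lt g b' v').mul_right (d.semi_Lt g b v)) h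
  have xc : ∀ i k, SE (d.Lt false (.inl i) * d.Lt true (.inl k))
      (d.Lt true (.inl k) * d.Lt false (.inl i)) := by
    intro i k
    have h := key (Equiv.swap 0 i, 1) false true (.inl 0) (.inl (Equiv.swap 0 i k))
    simp only [act_inl, Equiv.swap_apply_left, Equiv.swap_apply_self] at h
    apply h
    simp only [Lt, cj_zero]
    by_cases h0 : Equiv.swap 0 i k = 0
    · rw [h0]; exact .of_neg d.x1_c1
    · exact .of_eq (d.x1_c _ h0)
  have xcb : ∀ i k, SE (d.Lt false (.inr i) * d.Lt true (.inr k))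
      (d.Lt true (.inr k) * d.Lt false (.inr i)) := by
    intro i k
    have h := key (1, Equiv.swap 0 i) false true (.inr 0) (.inr (Equiv.swap 0 i k))
    simp only [act_inr, Equiv.swap_apply_left, Equiv.swap_apply_self] at h
    apply h
    simp only [Lt, cj_zero]
    by_cases h0 : Equiv.swap 0 i k = 0
    · rw [h0]; exact .of_neg d.xb1_cb1
    · exact .of_eq (d.xb1_cb _ h0)
  have xcm : ∀ i k, SE (d.Lt false (.inl i) * d.Lt true (.inr k))
      (d.Lt true (.inr k) * d.Lt false (.inl i)) := by
    intro i k
    have h := key (Equiv.swap 0 i, 1) false true (.inl 0) (.inr k)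
    simp only [act_inl, act_inr, Equiv.swap_apply_left, Equiv.Perm.one_apply] at h
    apply h
    simp only [Lt, cj_zero]
    exact .of_eq (d.x1_cb_comm _)
  have cxm : ∀ i k, SE (d.Lt false (.inr i) * d.Lt true (.inl k))
      (d.Lt true (.inl k) * d.Lt false (.inr i)) := by
    intro i k
    have h := key (1, Equiv.swap 0 i) false true (.inr 0) (.inl k)
    simp only [act_inl, act_inr, Equiv.swap_apply_left, Equiv.Perm.one_apply] at h
    apply h
    simp only [Lt, cj_zero]
    exact .of_eq (d.xb1_c_comm _)
  have xxm : ∀ i k, SE (d.Lt false (.inl i) * d.Lt false (.inr k))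
      (d.Lt false (.inr k) * d.Lt false (.inl i)) := by
    intro i k
    have h := key (Equiv.swap 0 i, Equiv.swap 0 k) false false (.inl 0) (.inr 0)
    simp only [act_inl, act_inr, Equiv.swap_apply_left] at h
    apply h
    simp only [Lt, cj_zero]
    exact .of_eq d.x_xb
  rcases b with _ | _ <;> rcases b' with _ | _ <;> rcases v with i | i <;> rcases v' with k | k
  · by_cases hik : i = k
    · subst hik; exact .refl _
    · have h1 : 1 < r + 1 := by omega
      obtain ⟨w, rfl, rfl⟩ := exists_perm_two h1 i k hik
      refine key (w, 1) _ _ (.inl 0) (.inl ⟨1, h1⟩) ?_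
      have := d.x_comm h1
      rw [sw01 _ h1] at this
      simp only [Lt, cj_zero]
      exact .of_eq this
  · exact xxm _ _
  · exact (xxm _ _).symm
  · by_cases hik : i = k
    · subst hik; exact .refl _
    · have h1 : 1 < t + 1 := by omega
      obtain ⟨w, rfl, rfl⟩ := exists_perm_two h1 i k hik
      refine key (1, w) _ _ (.inr 0) (.inr ⟨1, h1⟩) ?_
      have := d.xb_comm h1
      rw [sw01 _ h1] at this
      simp only [Lt, cj_zero]
      exact .of_eq this
  · exact xc _ _
  · exact xcm _ _
  · exact cxm _ _
  · exact xcb _ _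
  · exact (xc _ _).symm
  · exact (cxm _ _).symm
  · exact (xcm _ _).symm
  · exact (xcb _ _).symm
  · by_cases hik : i = k
    · subst hik; exact .refl _
    · exact .of_neg (d.c_anti _ _ hik)
  · exact .of_neg (d.anti_ccb _ _)
  · exact .of_neg (by rw [Lt, Lt, d.anti_ccb, neg_neg])
  · by_cases hik : i = k
    · subst hik; exact .refl _
    · exact .of_neg (d.cb_anti _ _ hik)

/-- letters commute with distant `e` -/
theorem Lt_EE_comm (b : Bool) (v : Vx r t) (i j) (hi : v ≠ .inl i) (hj : v ≠ .inr j) :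
    SE (d.Lt b v * d.EE i j) (d.EE i j * d.Lt b v) := by
  have key : ∀ (g : Gp r t) b v i j, SE (d.Lt b v * d.EE i j) (d.EE i j * d.Lt b v) →
      SE (d.Lt b (act g v) * d.EE (g.1 i) (g.2 j)) (d.EE (g.1 i) (g.2 j) * d.Lt b (act g v)) :=
    fun g b v i j h => d.semi_SE g ((d.semi_Lt g b v).mul_right (d.semi_EE g i j))
      ((d.semi_EE g i j).mul_right (d.semi_Lt g b v)) h
  have base : ∀ v, v ≠ .inl 0 → v ≠ .inr 0 → SE (d.Lt b v * d.EE 0 0) (d.EE 0 0 * d.Lt b v) := by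
    intro v h h'
    rcases b with _ | _ <;> rcases v with k | k
    · have hk : k ≠ 0 := by simpa using h
      have h1 : 1 < r + 1 := by
        have := k.2; have : (k : ℕ) ≠ 0 := fun h => hk (Fin.ext h); omega
      obtain ⟨w, h0, rfl⟩ := exists_perm_one h1 k hk
      have := key (w, 1) false (.inl ⟨1, h1⟩) 0 0
      simp only [act_inl, h0, Equiv.Perm.one_apply] at this
      apply this
      have h3 := d.e_sxs h1
      rw [sw01 _ h1] at h3
      rw [EE_zero]
      exact .of_eq h3.symm
    · have hk : k ≠ 0 := by simpa using h'
      have h1 : 1 < t + 1 := by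
        have := k.2; have : (k : ℕ) ≠ 0 := fun h => hk (Fin.ext h); omega
      obtain ⟨w, h0, rfl⟩ := exists_perm_one h1 k hk
      have := key (1, w) false (.inr ⟨1, h1⟩) 0 0
      simp only [act_inr, h0, Equiv.Perm.one_apply] at this
      apply this
      have h3 := d.e_sbxbsb h1
      rw [sw01 _ h1] at h3
      rw [EE_zero]
      exact .of_eq h3.symm
    · have hk : k ≠ 0 := by simpa using h
      rw [EE_zero]
      exact .of_eq (d.c_e_comm k (fun h => hk (Fin.ext h)))
    · have hk : k ≠ 0 := by simpa using h'
      rw [EE_zero]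
      exact .of_eq (d.cb_e_comm k (fun h => hk (Fin.ext h)))
  have := key (Equiv.swap 0 i, Equiv.swap 0 j) b (act (Equiv.swap 0 i, Equiv.swap 0 j) v) 0 0
  have hv : act (Equiv.swap 0 i, Equiv.swap 0 j) (act (Equiv.swap 0 i, Equiv.swap 0 j) v) = v := by
    cases v <;> simp
  rw [hv] at this
  simp only [Equiv.swap_apply_left] at this
  apply this
  apply base
  · rintro h
    rw [h] at hv
    simp at hv
    exact hi hv.symm
  · rintro h
    rw [h] at hv
    simp at hv
    exact hj hv.symm

theorem Lt_EE (b : Bool) (i j) : SE (d.Lt b (.inr j) * d.EE i j) (d.Lt b (.inl i) * d.EE i j) := by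
  have h := fun hh => d.semi_SE (Equiv.swap 0 i, Equiv.swap 0 j)
    ((d.semi_Lt _ b (.inr 0)).mul_right (d.semi_EE _ 0 0))
    ((d.semi_Lt _ b (.inl 0)).mul_right (d.semi_EE _ 0 0)) hh
  simp only [act_inl, act_inr, Equiv.swap_apply_left] at h
  apply h
  rw [EE_zero]
  cases b
  · simp only [Lt, cj_zero]
    have := d.xsum_e
    rw [add_mul] at this
    exact .of_neg (eq_neg_of_add_eq_zero_right this)
  · exact .of_eq (d.c1_e (by omega) (by omega)).symm

theorem EE_Lt (b : Bool) (i j) : SE (d.EE i j * d.Lt b (.inl i)) (d.EE i j * d.Lt b (.inr j)) := by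
  have h := fun hh => d.semi_SE (Equiv.swap 0 i, Equiv.swap 0 j)
    ((d.semi_EE _ 0 0).mul_right (d.semi_Lt _ b (.inl 0)))
    ((d.semi_EE _ 0 0).mul_right (d.semi_Lt _ b (.inr 0))) hh
  simp only [act_inl, act_inr, Equiv.swap_apply_left] at h
  apply h
  rw [EE_zero]
  cases b
  · simp only [Lt, cj_zero]
    have := d.e_xsum
    rw [mul_add] at this
    exact .of_neg (eq_neg_of_add_eq_zero_left this)
  · exact .of_eq (d.e_c1 (by omega) (by omega))

theorem swap_sq (w : Equiv.Perm (Fin (r + 1))) (h : w * w = 1) (a : B) :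
    d.σ w * (d.σ w * a) = a := by rw [← mul_assoc, ← map_mul, h]; simp
theorem swapb_sq (w : Equiv.Perm (Fin (t + 1))) (h : w * w = 1) (a : B) :
    d.σb w * (d.σb w * a) = a := by rw [← mul_assoc, ← map_mul, h]; simp

theorem EE_one_one (h : 1 < r + 1) (h' : 1 < t + 1) : d.EE ⟨1, h⟩ ⟨1, h'⟩ =
    d.σ (sw (r + 1) 0 1) * d.σb (sw (t + 1) 0 1) * d.e * d.σ (sw (r + 1) 0 1)
      * d.σb (sw (t + 1) 0 1) := by
  rw [EE, cj, cj, sw01 _ h, sw01 _ h', d.comm_σσb]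
  simp only [mul_assoc]

theorem e_EE_one (h : 1 < r + 1) (h' : 1 < t + 1) : d.e * d.EE ⟨1, h⟩ ⟨1, h'⟩ =
    d.e * d.σ (sw (r + 1) 0 1) * d.σb (sw (t + 1) 0 1) * d.e := by
  have h2 := congrArg (· * d.σb (sw (t + 1) 0 1)) (d.braid1 h h')
  rw [EE_one_one]
  rw [mul_assoc _ (d.σb (sw (t + 1) 0 1)) (d.σb (sw (t + 1) 0 1)), ← map_mul] at h2
  rw [sw01 _ h'] at *
  simp only [Equiv.swap_mul_self, map_one, mul_one] at h2
  rw [← h2]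
  simp only [mul_assoc]

theorem EE_one_e (h : 1 < r + 1) (h' : 1 < t + 1) : d.EE ⟨1, h⟩ ⟨1, h'⟩ * d.e =
    d.e * d.σ (sw (r + 1) 0 1) * d.σb (sw (t + 1) 0 1) * d.e := by
  have h2 := congrArg (d.σb (sw (t + 1) 0 1) * ·) (d.braid2 h h')
  simp only [mul_assoc] at h2
  rw [d.swapb_sq _ (by rw [sw01 _ h']; simp)] at h2
  rw [EE_one_one, d.comm_σσb]
  simp only [mul_assoc]
  exact h2

theorem EE_comm (i j k l) (h : i ≠ k) (h' : j ≠ l) : Commute (d.EE i j) (d.EE k l) := by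
  have h1 : 1 < r + 1 := by omega
  have h1' : 1 < t + 1 := by omega
  obtain ⟨w, rfl, rfl⟩ := exists_perm_two h1 i k h
  obtain ⟨v, rfl, rfl⟩ := exists_perm_two h1' j l h'
  refine d.semi_eq (w, v) ((d.semi_EE (w, v) _ _).mul_right (d.semi_EE (w, v) _ _))
    ((d.semi_EE (w, v) _ _).mul_right (d.semi_EE (w, v) _ _)) ?_
  rw [EE_zero, EE_one_e, e_EE_one]

theorem conj_swap {n : ℕ} (w : Equiv.Perm (Fin n)) (a b : Fin n) :
    w * Equiv.swap a b * w⁻¹ = Equiv.swap (w a) (w b) := by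
  rw [Equiv.swap_apply_apply]

theorem EE_EE_swap (i j k l) (h : i ≠ k) (h' : j ≠ l) :
    d.EE i j * d.EE k l * d.ρ (Equiv.swap i k, Equiv.swap j l) = d.EE i j * d.EE k l := by
  have h1 : 1 < r + 1 := by omega
  have h1' : 1 < t + 1 := by omega
  obtain ⟨w, rfl, rfl⟩ := exists_perm_two h1 i k h
  obtain ⟨v, rfl, rfl⟩ := exists_perm_two h1' j l h'
  have h3 := d.semi_ρ (w, v) (Equiv.swap 0 ⟨1, h1⟩, Equiv.swap 0 ⟨1, h1'⟩)
  simp only [Prod.mk_mul_mk, Prod.inv_mk, conj_swap] at h3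
  refine d.semi_eq (w, v)
    (((d.semi_EE (w, v) _ _).mul_right (d.semi_EE (w, v) _ _)).mul_right h3)
    ((d.semi_EE (w, v) _ _).mul_right (d.semi_EE (w, v) _ _)) ?_
  rw [EE_zero]
  conv_lhs => rw [EE_one_one]
  rw [e_EE_one, sw01 _ h1, sw01 _ h1', mul_assoc (_ * d.e) (d.σ _) (d.σb _)]
  have h5 : d.σ (Equiv.swap 0 ⟨1, h1⟩) * d.σb (Equiv.swap 0 ⟨1, h1'⟩)
    = d.ρ (Equiv.swap 0 ⟨1, h1⟩, Equiv.swap 0 ⟨1, h1'⟩) := rfl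
  rw [mul_assoc, mul_assoc _ _ (d.ρ _), h5, ← map_mul]
  simp only [Prod.mk_mul_mk, Equiv.swap_mul_self]
  rw [← Prod.one_eq_mk, map_one, mul_one, ← h5]
  simp only [mul_assoc]

theorem e_EE_inl (k : Fin (r + 1)) (h : k ≠ 0) :
    d.e * d.EE k 0 = d.e * d.ρ (Equiv.swap 0 k, 1) := by
  have h1 : 1 < r + 1 := by omega
  obtain ⟨w, h0, rfl⟩ := exists_perm_one h1 k h
  have h3 := d.semi_ρ (w, 1) (Equiv.swap 0 ⟨1, h1⟩, 1)
  simp only [Prod.mk_mul_mk, Prod.inv_mk, conj_swap, h0, inv_one, mul_one] at h3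
  have h4 := d.semi_EE (w, 1) 0 0
  simp only [h0, Equiv.Perm.one_apply, EE_zero] at h4
  have h5 := d.semi_EE (w, 1) ⟨1, h1⟩ 0
  simp only [Equiv.Perm.one_apply] at h5
  refine d.semi_eq (w, 1) (h4.mul_right h5) (h4.mul_right h3) ?_
  rw [EE, cj_zero, cj, ρ_inl, ← sw01, ← mul_assoc, ← mul_assoc, d.e_s_e h1]

theorem e_EE_inr (k : Fin (t + 1)) (h : k ≠ 0) :
    d.e * d.EE 0 k = d.e * d.ρ (1, Equiv.swap 0 k) := by
  have h1 : 1 < t + 1 := by omega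
  obtain ⟨w, h0, rfl⟩ := exists_perm_one h1 k h
  have h3 := d.semi_ρ (1, w) (1, Equiv.swap 0 ⟨1, h1⟩)
  simp only [Prod.mk_mul_mk, Prod.inv_mk, conj_swap, h0, inv_one, mul_one] at h3
  have h4 := d.semi_EE (1, w) 0 0
  simp only [h0, Equiv.Perm.one_apply, EE_zero] at h4
  have h5 := d.semi_EE (1, w) 0 ⟨1, h1⟩
  simp only [Equiv.Perm.one_apply] at h5
  refine d.semi_eq (1, w) (h4.mul_right h5) (h4.mul_right h3) ?_
  rw [EE, cj_zero, cj, ρ_inr, ← sw01, ← mul_assoc, ← mul_assoc, d.e_sb_e h1]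

end GData

namespace GData
variable {R B : Type} [CommRing R] [Ring B] [Algebra R B] {r t : ℕ} (d : GData R B r t)

/-- words in the top unbarred letters -/
def W (τ : List (Bool × Fin (r + 1))) : B := (τ.map (fun p => d.Lt p.1 (.inl p.2))).prod
/-- words in the bottom barred letters -/
def Wb (τ : List (Bool × Fin (t + 1))) : B := (τ.map (fun p => d.Lt p.1 (.inr p.2))).prod
/-- products of `e`'s along a partial matching -/
def EM (M : List (Fin (r + 1) × Fin (t + 1))) : B := (M.map (fun p => d.EE p.1 p.2)).prod
/-- partial matchings -/
def OK (M : List (Fin (r + 1) × Fin (t + 1))) : Prop :=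
  M.Pairwise (fun p q => p.1 ≠ q.1 ∧ p.2 ≠ q.2)

theorem W_cons (p τ) : d.W (p :: τ) = d.Lt p.1 (.inl p.2) * d.W τ := by simp [W]
theorem Wb_cons (p τ) : d.Wb (p :: τ) = d.Lt p.1 (.inr p.2) * d.Wb τ := by simp [Wb]
theorem W_snoc (p τ) : d.W (τ ++ [p]) = d.W τ * d.Lt p.1 (.inl p.2) := by simp [W]
theorem EM_cons (p M) : d.EM (p :: M) = d.EE p.1 p.2 * d.EM M := by simp [EM]

theorem OK_perm {M M' : List (Fin (r + 1) × Fin (t + 1))} (h : M.Perm M') (hM : OK M) : OK M' :=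
  (h.pairwise_iff (by intro x y hxy; exact ⟨hxy.1.symm, hxy.2.symm⟩)).1 hM

theorem EM_perm {M M' : List (Fin (r + 1) × Fin (t + 1))} (h : M.Perm M') (hM : OK M) :
    d.EM M = d.EM M' := by
  refine (h.map _).prod_eq' ?_
  rw [List.pairwise_map]
  exact hM.imp (fun hpq => d.EE_comm _ _ _ _ hpq.1 hpq.2)

theorem semi_list {ι : Type} (g : B) (y y' : ι → B) (h : ∀ i, SemiconjBy g (y i) (y' i))
    (l : List ι) : SemiconjBy g (l.map y).prod (l.map y').prod := by
  induction l with
  | nil => simp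
  | cons a l ih => simpa using (h a).mul_right ih

theorem semi_W (g : Gp r t) (τ) :
    SemiconjBy (d.ρ g) (d.W τ) (d.W (τ.map (fun p => (p.1, g.1 p.2)))) := by
  rw [W, W, List.map_map]
  exact semi_list _ _ _ (fun (i : Bool × Fin (r + 1)) => d.semi_Lt g i.1 (.inl i.2)) _

theorem semi_EM (g : Gp r t) (M) :
    SemiconjBy (d.ρ g) (d.EM M) (d.EM (M.map (fun p => (g.1 p.1, g.2 p.2)))) := by
  rw [EM, EM, List.map_map]
  exact semi_list _ _ _ (fun (i : Fin (r + 1) × Fin (t + 1)) => d.semi_EE g i.1 i.2) _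

theorem OK_map (g : Gp r t) {M} (hM : OK M) : OK (M.map (fun p => (g.1 p.1, g.2 p.2))) := by
  rw [OK, List.pairwise_map]
  exact hM.imp (fun h => ⟨fun h' => h.1 (g.1.injective h'), fun h' => h.2 (g.2.injective h')⟩)

/-- monomials -/
def mon (τ : List (Bool × Fin (r + 1))) (M : List (Fin (r + 1) × Fin (t + 1))) (g : Gp r t)
    (τb : List (Bool × Fin (t + 1))) : B := d.W τ * (d.EM M * (d.ρ g * d.Wb τb))

/-- span of monomials -/
def K : Submodule R B := Submodule.span R {b | ∃ τ M g τb, OK M ∧ b = d.mon τ M g τb}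

theorem mon_mem {τ M g τb} (h : OK M) : d.mon τ M g τb ∈ d.K :=
  Submodule.subset_span ⟨_, _, _, _, h, rfl⟩

theorem K_left (y : B) (h : ∀ τ M g τb, OK M → y * d.mon τ M g τb ∈ d.K) {z : B} (hz : z ∈ d.K) :
    y * z ∈ d.K := by
  induction hz using Submodule.span_induction with
  | mem x hx => obtain ⟨τ, M, g, τb, hM, rfl⟩ := hx; exact h _ _ _ _ hM
  | zero => simp
  | add a b _ _ ha hb => rw [mul_add]; exact add_mem ha hb
  | smul c a _ ha => rw [mul_smul_comm]; exact d.K.smul_mem c ha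

theorem K_one : (1 : B) ∈ d.K := by
  have := d.mon_mem (τ := []) (M := []) (g := 1) (τb := []) List.Pairwise.nil
  simpa [mon, W, EM, Wb] using this

theorem K_ρ (g : Gp r t) {z : B} (hz : z ∈ d.K) : d.ρ g * z ∈ d.K := by
  refine d.K_left _ (fun τ M h τb hM => ?_) hz
  rw [mon, ← mul_assoc, d.semi_W g, mul_assoc, ← mul_assoc (d.ρ g), d.semi_EM g, mul_assoc,
    ← mul_assoc (d.ρ g), ← map_mul]
  exact d.mon_mem (OK_map g hM)

theorem K_inl (b i) {z : B} (hz : z ∈ d.K) : d.Lt b (.inl i) * z ∈ d.K := by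
  refine d.K_left _ (fun τ M h τb hM => ?_) hz
  have := d.W_cons (b, i) τ
  rw [mon, ← mul_assoc, ← this]
  exact d.mon_mem hM

theorem Lt_W (b v τ) : SE (d.Lt b v * d.W τ) (d.W τ * d.Lt b v) :=
  SE.comm_list _ _ (fun _ _ => d.Lt_comm _ _ _ _)

theorem Lt_EM (b v M) (h : ∀ p ∈ M, v ≠ .inl p.1 ∧ v ≠ .inr p.2) :
    SE (d.Lt b v * d.EM M) (d.EM M * d.Lt b v) :=
  SE.comm_list _ _ (fun p hp => d.Lt_EE_comm _ _ _ _ (h p hp).1 (h p hp).2)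

theorem Lt_inr_EM (b) (p : Fin (r + 1) × Fin (t + 1)) (M) (hM : OK M) (hp : p ∈ M) :
    SE (d.Lt b (.inr p.2) * d.EM M) (d.Lt b (.inl p.1) * d.EM M) := by
  rw [d.EM_perm (List.perm_cons_erase hp) hM, EM_cons, ← mul_assoc, ← mul_assoc]
  exact (d.Lt_EE _ _ _).mul_right _

theorem Lt_inr_EM_free (b) (j : Fin (t + 1)) (M) (h : ∀ p ∈ M, j ≠ p.2) (g : Gp r t) (τb) :
    SE (d.Lt b (.inr j) * (d.EM M * (d.ρ g * d.Wb τb)))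
      (d.EM M * (d.ρ g * d.Wb ((b, g.2⁻¹ j) :: τb))) := by
  have h1 := (d.Lt_EM b (.inr j) M (fun p hp => by simpa using h p hp)).mul_right (d.ρ g * d.Wb τb)
  have h2 := d.semi_Lt g b (.inr (g.2⁻¹ j))
  have hj : g.2 (g.2⁻¹ j) = j := by simp
  rw [act_inr, hj] at h2
  rw [Wb_cons]
  simp only [mul_assoc] at h1
  rw [← mul_assoc (d.ρ g) (d.Lt _ _), h2]
  simpa only [mul_assoc] using h1

theorem K_inr (b j) {z : B} (hz : z ∈ d.K) : d.Lt b (.inr j) * z ∈ d.K := by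
  refine d.K_left _ (fun τ M g τb hM => ?_) hz
  have h1 := (d.Lt_W b (.inr j) τ).mul_right (d.EM M * (d.ρ g * d.Wb τb))
  rw [mon, ← mul_assoc]
  refine h1.mem ?_
  rw [mul_assoc]
  by_cases hj : ∃ p ∈ M, j = p.2
  · obtain ⟨p, hp, rfl⟩ := hj
    have h2 := ((d.Lt_inr_EM b p M hM hp).mul_right (d.ρ g * d.Wb τb)).mul_left (d.W τ)
    simp only [mul_assoc] at h2
    refine h2.mem ?_
    have h3 := d.W_snoc (b, p.1) τ
    rw [← mul_assoc, ← h3]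
    exact d.mon_mem hM
  · push Not at hj
    exact ((d.Lt_inr_EM_free b j M hj g τb).mul_left (d.W τ)).mem (d.mon_mem hM)

theorem Lt_e (b v) (h : v ≠ .inl 0) (h' : v ≠ .inr 0) : SE (d.e * d.Lt b v) (d.Lt b v * d.e) := by
  have := d.Lt_EE_comm b v 0 0 h h'
  rw [EE_zero] at this
  exact this.symm

theorem e_xc (h2 : IsUnit (2 : R)) (a : ℕ) : d.e * d.x1 ^ a * d.c 0 * d.e = 0 := by
  cases a with
  | zero => simpa using d.e_c_e (by omega)
  | succ a =>
    have hx : d.x1 * d.e = -(d.xb1 * d.e) := by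
      have := d.xsum_e
      rw [add_mul] at this
      exact eq_neg_of_add_eq_zero_left this
    have hx' : d.e * d.xb1 = -(d.e * d.x1) := by
      have := d.e_xsum
      rw [mul_add] at this
      exact eq_neg_of_add_eq_zero_right this
    have hpow : d.x1 ^ a * d.xb1 = d.xb1 * d.x1 ^ a := (Commute.pow_left d.x_xb a : _)
    have h : d.e * d.x1 ^ (a + 1) * d.c 0 * d.e = -(d.e * d.x1 ^ (a + 1) * d.c 0 * d.e) := by
      calc d.e * d.x1 ^ (a + 1) * d.c 0 * d.e
          = d.e * d.x1 ^ a * (d.x1 * d.c 0) * d.e := by rw [pow_succ]; simp only [mul_assoc]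
        _ = -(d.e * d.x1 ^ a * d.c 0 * (d.x1 * d.e)) := by
            rw [d.x1_c1]; simp only [mul_assoc, neg_mul, mul_neg]
        _ = d.e * d.x1 ^ a * (d.c 0 * d.xb1) * d.e := by
            rw [hx]; simp only [mul_assoc, mul_neg, neg_neg]
        _ = d.e * (d.x1 ^ a * d.xb1) * d.c 0 * d.e := by
            rw [← d.xb1_c_comm]; simp only [mul_assoc]
        _ = (d.e * d.xb1) * d.x1 ^ a * d.c 0 * d.e := by
            rw [hpow]; simp only [mul_assoc]
        _ = _ := by rw [hx', pow_succ']; simp only [mul_assoc, neg_mul]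
    generalize d.e * d.x1 ^ (a + 1) * d.c 0 * d.e = z at h
    have hz : (2 : R) • z = 0 := by
      rw [two_smul]; nth_rewrite 1 [h]; simp
    obtain ⟨u, hu⟩ := h2
    rw [← hu] at hz
    have := congrArg ((↑u⁻¹ : R) • ·) hz
    simpa [smul_smul] using this

theorem e_W_e (h2 : IsUnit (2 : R)) (τ : List (Bool × Fin (r + 1))) (a : ℕ) :
    d.e * d.x1 ^ a * d.W τ * d.e = 0 ∧ d.e * d.x1 ^ a * d.c 0 * d.W τ * d.e = 0 := by
  induction τ generalizing a with
  | nil => simpa [W] using ⟨d.e_xpow a, d.e_xc h2 a⟩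
  | cons p τ ih =>
    obtain ⟨b, i⟩ := p
    rw [W_cons]
    by_cases hi : i = 0
    · subst hi
      cases b
      · simp only [Lt, cj_zero]
        constructor
        · have := (ih (a + 1)).1
          rw [pow_succ] at this
          simpa only [mul_assoc] using this
        · have := (ih (a + 1)).2
          rw [pow_succ] at this
          have h3 : d.e * d.x1 ^ a * d.c 0 * (d.x1 * d.W τ) * d.e
              = - (d.e * d.x1 ^ a * (-(d.c 0 * d.x1)) * d.W τ * d.e) := by
            simp only [mul_assoc, neg_mul, mul_neg, neg_neg]
          rw [h3, ← d.x1_c1]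
          simp only [mul_assoc] at this ⊢
          rw [this, neg_zero]
      · simp only [Lt]
        constructor
        · simpa only [mul_assoc] using (ih a).2
        · have h3 : d.e * d.x1 ^ a * d.c 0 * (d.c 0 * d.W τ) * d.e
              = d.e * d.x1 ^ a * (d.c 0 * d.c 0) * d.W τ * d.e := by
            simp only [mul_assoc]
          rw [h3, d.c_sq]
          simpa using (ih a).1
    · have hx : SE (d.Lt b (.inl i) * d.x1 ^ a) (d.x1 ^ a * d.Lt b (.inl i)) := by
        have := d.Lt_comm b false (.inl i) (.inl 0)
        simp only [Lt, cj_zero] at this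
        exact this.comm_pow a
      have hc : SE (d.Lt b (.inl i) * d.c 0) (d.c 0 * d.Lt b (.inl i)) :=
        d.Lt_comm b true (.inl i) (.inl 0)
      have he : SE (d.Lt b (.inl i) * d.e) (d.e * d.Lt b (.inl i)) :=
        (d.Lt_e b (.inl i) (by simpa using hi) (by simp)).symm
      have h1 := ((he.comm_mul hx).symm.mul_right (d.W τ)).mul_right d.e
      have h2 := (((he.comm_mul hx).comm_mul hc).symm.mul_right (d.W τ)).mul_right d.e
      constructor
      · rw [← mul_assoc]
        refine h1.eq_zero ?_
        have := (ih a).1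
        simp only [mul_assoc] at this ⊢
        rw [this, mul_zero]
      · rw [← mul_assoc]
        refine h2.eq_zero ?_
        have := (ih a).2
        simp only [mul_assoc] at this ⊢
        rw [this, mul_zero]

theorem e_EM_mem (M) (hM : OK M) (g : Gp r t) (τb) : d.e * d.e = 0 →
    d.e * (d.EM M * (d.ρ g * d.Wb τb)) ∈ d.K := by
  intro hee
  by_cases h00 : ∃ j, (0, j) ∈ M
  · obtain ⟨j, hj⟩ := h00
    have hp := List.perm_cons_erase hj
    rw [d.EM_perm hp hM, EM_cons]
    have hre : ∀ M', d.e * (d.EE 0 j * d.EM M' * (d.ρ g * d.Wb τb))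
        = d.e * d.EE 0 j * (d.EM M' * (d.ρ g * d.Wb τb)) := by
      intro M'; simp only [mul_assoc]
    dsimp only
    rw [hre]
    have hO := OK_perm hp hM
    generalize M.erase (0, j) = M' at *
    rw [OK, List.pairwise_cons] at hO
    by_cases hj0 : j = 0
    · subst hj0
      simp only [EE_zero, hee, zero_mul]; exact d.K.zero_mem
    · rw [d.e_EE_inr j hj0]
      rw [mul_assoc, ← mul_assoc (d.ρ _), d.semi_EM, ← d.EE_zero, ← mul_assoc,
        ← mul_assoc (d.EE 0 0) (d.EM _) (d.ρ _)]
      have := d.EM_cons (0, 0) (M'.map (fun p => ((1 : Equiv.Perm (Fin (r + 1))) p.1,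
        (Equiv.swap 0 j) p.2)))
      dsimp only at this ⊢
      rw [← this, mul_assoc, ← mul_assoc (d.ρ _), ← map_mul]
      have := d.mon_mem (τ := []) (M := (0, 0) :: (M'.map (fun p =>
        ((1 : Equiv.Perm (Fin (r + 1))) p.1, (Equiv.swap 0 j) p.2))))
        (g := (1, Equiv.swap 0 j) * g) (τb := τb) ?_
      · simpa [mon, W] using this
      · rw [OK, List.pairwise_cons]
        refine ⟨?_, OK_map (1, Equiv.swap 0 j) hO.2⟩
        intro p hp
        rw [List.mem_map] at hp
        obtain ⟨q, hq, rfl⟩ := hp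
        refine ⟨(hO.1 q hq).1, fun h => (hO.1 q hq).2 ?_⟩
        simp only at h ⊢
        rw [eq_comm, Equiv.swap_apply_eq_iff] at h
        simpa using h.symm
  · by_cases h00' : ∃ i, (i, 0) ∈ M
    · obtain ⟨j, hj⟩ := h00'
      have hj0 : j ≠ 0 := by rintro rfl; exact h00 ⟨0, hj⟩
      have hp := List.perm_cons_erase hj
      rw [d.EM_perm hp hM, EM_cons]
      have hre : ∀ M', d.e * (d.EE j 0 * d.EM M' * (d.ρ g * d.Wb τb))
          = d.e * d.EE j 0 * (d.EM M' * (d.ρ g * d.Wb τb)) := by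
        intro M'; simp only [mul_assoc]
      dsimp only
      rw [hre]
      have hO := OK_perm hp hM
      generalize M.erase (j, 0) = M' at *
      rw [OK, List.pairwise_cons] at hO
      rw [d.e_EE_inl j hj0]
      rw [mul_assoc, ← mul_assoc (d.ρ _), d.semi_EM, ← d.EE_zero, ← mul_assoc,
        ← mul_assoc (d.EE 0 0) (d.EM _) (d.ρ _)]
      have := d.EM_cons (0, 0) (M'.map (fun p => ((Equiv.swap 0 j) p.1,
        (1 : Equiv.Perm (Fin (t + 1))) p.2)))
      dsimp only at this ⊢
      rw [← this, mul_assoc, ← mul_assoc (d.ρ _), ← map_mul]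
      have := d.mon_mem (τ := []) (M := (0, 0) :: (M'.map (fun p =>
        ((Equiv.swap 0 j) p.1, (1 : Equiv.Perm (Fin (t + 1))) p.2))))
        (g := (Equiv.swap 0 j, 1) * g) (τb := τb) ?_
      · simpa [mon, W] using this
      · rw [OK, List.pairwise_cons]
        refine ⟨?_, OK_map (Equiv.swap 0 j, 1) hO.2⟩
        intro p hp
        rw [List.mem_map] at hp
        obtain ⟨q, hq, rfl⟩ := hp
        refine ⟨fun h => (hO.1 q hq).1 ?_, (hO.1 q hq).2⟩
        simp only at h ⊢
        rw [eq_comm, Equiv.swap_apply_eq_iff] at h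
        simpa using h.symm
    · have := d.mon_mem (τ := []) (M := (0, 0) :: M) (g := g) (τb := τb) ?_
      · simpa [mon, W, EM_cons, EE_zero, mul_assoc] using this
      · rw [OK, List.pairwise_cons]
        refine ⟨?_, hM⟩
        intro p hp
        refine ⟨fun h => h00 ⟨p.2, ?_⟩, fun h => h00' ⟨p.1, ?_⟩⟩
        · simp only at h; rw [h]; exact hp
        · simp only at h; rw [h]; exact hp

theorem e_mon_mem (h2 : IsUnit (2 : R)) (τ M) (hM : OK M) (g : Gp r t) (τb) :
    d.e * d.mon τ M g τb ∈ d.K := by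
  by_cases h00 : ((0, 0) : Fin (r + 1) × Fin (t + 1)) ∈ M
  · have hp := List.perm_cons_erase h00
    rw [mon, d.EM_perm hp hM, EM_cons, EE_zero]
    have := (d.e_W_e h2 τ 0).1
    simp only [pow_zero, mul_one] at this
    have h3 : d.e * (d.W τ * (d.e * d.EM (M.erase (0, 0)) * (d.ρ g * d.Wb τb)))
        = d.e * d.W τ * d.e * (d.EM (M.erase (0, 0)) * (d.ρ g * d.Wb τb)) := by
      simp only [mul_assoc]
    rw [h3, this, zero_mul]
    exact zero_mem _
  induction τ generalizing τb with
  | nil =>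
    have := d.e_EM_mem M hM g τb d.e_sq
    simpa [mon, W] using this
  | cons p τ ih =>
    obtain ⟨b, i⟩ := p
    have e1 : d.e * d.mon ((b, i) :: τ) M g τb = (d.e * d.Lt b (.inl i)) * d.mon τ M g τb := by
      rw [mon, W_cons, mon]; simp only [mul_assoc]
    rw [e1]
    by_cases hi : i = 0
    swap
    · refine ((d.Lt_e b (.inl i) (by simpa using hi) (by simp)).mul_right _).mem ?_
      rw [mul_assoc]
      exact d.K_inl _ _ (ih _)
    subst hi
    by_cases hA : ∃ j, ((0 : Fin (r + 1)), j) ∈ M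
    · obtain ⟨j, hj⟩ := hA
      have hj0 : j ≠ 0 := by rintro rfl; exact h00 hj
      have q1 := ((d.Lt_W b (.inl 0) τ).mul_right (d.EM M * (d.ρ g * d.Wb τb))).mul_left d.e
      have q2 := ((((d.Lt_inr_EM b (0, j) M hM hj).symm).mul_right (d.ρ g * d.Wb τb)).mul_left
        (d.W τ)).mul_left d.e
      have q3 := ((d.Lt_W b (.inr j) τ).symm.mul_right (d.EM M * (d.ρ g * d.Wb τb))).mul_left d.e
      have q4 := (d.Lt_e b (.inr j) (by simp) (by simpa using hj0)).mul_right (d.mon τ M g τb)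
      rw [mon] at *
      simp only [mul_assoc] at q1 q2 q3 q4 ⊢
      exact (((q1.trans q2).trans q3).trans q4).mem (d.K_inr _ _ (ih _))
    have q0 := (d.EE_Lt b 0 0).mul_right (d.mon τ M g τb)
    have q1 := ((d.Lt_W b (.inr 0) τ).mul_right (d.EM M * (d.ρ g * d.Wb τb))).mul_left d.e
    rw [EE_zero] at q0
    by_cases hB : ∃ i, (i, (0 : Fin (t + 1))) ∈ M
    · obtain ⟨i, hi⟩ := hB
      have hi0 : i ≠ 0 := by rintro rfl; exact h00 hi
      have q2 := ((((d.Lt_inr_EM b (i, 0) M hM hi)).mul_right (d.ρ g * d.Wb τb)).mul_left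
        (d.W τ)).mul_left d.e
      have q3 := ((d.Lt_W b (.inl i) τ).symm.mul_right (d.EM M * (d.ρ g * d.Wb τb))).mul_left d.e
      have q4 := (d.Lt_e b (.inl i) (by simpa using hi0) (by simp)).mul_right (d.mon τ M g τb)
      rw [mon] at *
      simp only [mul_assoc] at q0 q1 q2 q3 q4 ⊢
      exact ((((q0.trans q1).trans q2).trans q3).trans q4).mem (d.K_inl _ _ (ih _))
    · have q2 := ((d.Lt_inr_EM_free b 0 M (fun p hp h => hB ⟨p.1, h ▸ hp⟩) g τb).mul_left
        (d.W τ)).mul_left d.e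
      rw [mon] at *
      simp only [mul_assoc] at q0 q1 q2 ⊢
      exact ((q0.trans q1).trans q2).mem (ih _)

theorem K_e (h2 : IsUnit (2 : R)) {z : B} (hz : z ∈ d.K) : d.e * z ∈ d.K :=
  d.K_left _ (fun τ M g τb hM => d.e_mon_mem h2 τ M hM g τb) hz

end GData

/-! ### Coset representatives -/

theorem sw_apply {n : ℕ} (a b : ℕ) (ha : a < n) (hb : b < n) (v : Fin n) :
    ((sw n a b v : Fin n) : ℕ) = if (v : ℕ) = a then b else if (v : ℕ) = b then a else v := by
  rw [sw_eq a b ha hb, Equiv.swap_apply_def]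
  simp only [Fin.ext_iff]
  split_ifs <;> rfl

theorem sIJ_self (n a : ℕ) : sIJ n a a = 1 := by simp [sIJ]

theorem sIJ_step (n a b : ℕ) (h : a < b) :
    sIJ n (a + 1) (b + 1) = sw n a (a + 1) * sIJ n (a + 2) (b + 1) := by
  rw [sIJ, if_pos (by omega)]
  by_cases h' : a + 2 < b + 1
  · rw [sIJ, if_pos h']
    have : b + 1 - (a + 1) = (b + 1 - (a + 2)) + 1 := by omega
    rw [this, List.range'_succ]
    simp
  · have hb : b = a + 1 := by omega
    subst hb
    rw [sIJ_self]
    have : a + 1 + 1 - (a + 1) = 1 := by omega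
    rw [this]
    simp

theorem sIJ_apply (n m a b : ℕ) (hab : a + m = b) (hb : b < n) (v : Fin n) :
    ((sIJ n (a + 1) (b + 1) v : Fin n) : ℕ) =
      if (v : ℕ) = b then a else if a ≤ v ∧ (v : ℕ) < b then v + 1 else v := by
  induction m generalizing a with
  | zero =>
    have : a = b := by omega
    subst this
    rw [sIJ_self]
    simp only [Equiv.Perm.one_apply]
    split_ifs <;> omega
  | succ m ih =>
    rw [sIJ_step _ _ _ (by omega), Equiv.Perm.mul_apply, sw_apply _ _ (by omega) (by omega),
      ih (a + 1) (by omega)]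
    split_ifs <;> omega

/-- the product of `sIJ`'s -/
def dprod (n f : ℕ) (b : Fin f → ℕ) : Equiv.Perm (Fin n) :=
  ((List.finRange f).reverse.map (fun (k : Fin f) => sIJ n ((k : ℕ) + 1) (b k))).prod

theorem dprod_succ (n f : ℕ) (b : Fin (f + 1) → ℕ) :
    dprod n (f + 1) b = sIJ n (f + 1) (b (Fin.last f)) * dprod n f (fun k => b k.castSucc) := by
  rw [dprod, List.finRange_succ_last]
  simp [dprod, Function.comp_def, List.map_reverse]

theorem exists_b (n f : ℕ) (J : Fin f → Fin n) (hJ : Function.Injective J) :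
    ∃ b : Fin f → ℕ, (∀ k : Fin f, (k : ℕ) + 1 ≤ b k) ∧ (∀ k, b k ≤ n) ∧
      (∀ k, ((dprod n f b (J k) : Fin n) : ℕ) = k) ∧
      (StrictMono J → (∀ k, b k = J k + 1) ∧ ∀ v, (∀ k, J k < v) → dprod n f b v = v) := by
  induction f with
  | zero => exact ⟨fun k => k.elim0, fun k => k.elim0, fun k => k.elim0, fun k => k.elim0,
      fun _ => ⟨fun k => k.elim0, fun v _ => by simp [dprod]⟩⟩
  | succ f ih =>
    obtain ⟨b, h1, h2, h3, h4⟩ := ih (fun k => J k.castSucc)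
      (fun a b h => Fin.castSucc_injective _ (hJ h))
    set v := dprod n f b (J (Fin.last f)) with hv
    have hvf : f ≤ (v : ℕ) := by
      by_contra hlt
      push Not at hlt
      have h5 := h3 ⟨v, hlt⟩
      have h6 := (dprod n f b).injective (Fin.ext h5 : _ = v)
      have h7 := hJ h6
      have := congrArg Fin.val h7
      simp at this
      omega
    have hb : (fun k : Fin f => (Fin.snoc b ((v : ℕ) + 1) : Fin (f + 1) → ℕ) k.castSucc) = b := by
      funext k; simp
    have hs := sIJ_apply n (v - f) f v (by omega) v.2
    refine ⟨Fin.snoc b ((v : ℕ) + 1), ?_, ?_, ?_, ?_⟩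
    · intro k
      refine Fin.lastCases ?_ (fun k => ?_) k
      · simp; omega
      · simpa using h1 k
    · intro k
      refine Fin.lastCases ?_ (fun k => ?_) k
      · have := v.2; simp
      · simpa using h2 k
    · intro k
      rw [dprod_succ, hb, Fin.snoc_last, Equiv.Perm.mul_apply, hs]
      refine Fin.lastCases ?_ (fun k => ?_) k
      · rw [← hv]; simp
      · rw [h3 k]
        have := k.2
        simp only [Fin.val_castSucc]
        split_ifs <;> omega
    · intro hm
      obtain ⟨h5, h6⟩ := h4 (fun a b h => hm (by simpa using h))
      have h7 : v = J (Fin.last f) := h6 _ (fun k => hm (Fin.castSucc_lt_last k))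
      constructor
      · intro k
        refine Fin.lastCases ?_ (fun k => ?_) k
        · simp [h7]
        · simpa using h5 k
      · intro u hu
        rw [dprod_succ, hb, Fin.snoc_last, Equiv.Perm.mul_apply]
        rw [h6 u (fun k => hu _)]
        apply Fin.ext
        rw [hs]
        have : (J (Fin.last f) : ℕ) < u := hu _
        rw [h7]
        split_ifs <;> omega

namespace GData
variable {R B : Type} [CommRing R] [Ring B] [Algebra R B] {r t : ℕ} (d : GData R B r t)

/-- the diagonal matching -/
def diag (r t f : ℕ) (hr : f ≤ r + 1) (ht : f ≤ t + 1) : List (Fin (r + 1) × Fin (t + 1)) :=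
  (List.finRange f).map (fun k => (Fin.castLE hr k, Fin.castLE ht k))

theorem E_eq (i : Fin (r + 1)) (j : Fin (t + 1)) : d.E ((i : ℕ) + 1) ((j : ℕ) + 1) = d.EE i j := by
  rw [WBC.E, WBC.tr, WBC.trb, EE, cj, cj]
  have h1 : sw (r + 1) (1 - 1) ((i : ℕ) + 1 - 1) = Equiv.swap 0 i := by
    simp only [Nat.sub_self, Nat.add_sub_cancel]
    rw [sw_eq _ _ (by omega) i.2]; rfl
  have h2 : sw (t + 1) (1 - 1) ((j : ℕ) + 1 - 1) = Equiv.swap 0 j := by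
    simp only [Nat.sub_self, Nat.add_sub_cancel]
    rw [sw_eq _ _ (by omega) j.2]; rfl
  rw [h1, h2]
  simp only [mul_assoc]

theorem epow_eq (f : ℕ) (hr : f ≤ r + 1) (ht : f ≤ t + 1) :
    d.epow f = d.EM (diag r t f hr ht) := by
  rw [WBC.epow, EM, diag, List.map_map, ← List.map_coe_finRange_eq_range, List.map_map]
  congr 1
  apply List.map_congr_left
  intro k _
  exact d.E_eq (Fin.castLE hr k) (Fin.castLE ht k)

theorem OK_ne {M : List (Fin (r + 1) × Fin (t + 1))} (hM : OK M) {p q} (hp : p ∈ M) (hq : q ∈ M)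
    (h : p ≠ q) : p.1 ≠ q.1 ∧ p.2 ≠ q.2 := by
  haveI : Std.Symm (fun p q : Fin (r + 1) × Fin (t + 1) => p.1 ≠ q.1 ∧ p.2 ≠ q.2) :=
    ⟨fun _ _ h => ⟨h.1.symm, h.2.symm⟩⟩
  exact List.Pairwise.forall hM hp hq h

theorem exists_D (M : List (Fin (r + 1) × Fin (t + 1))) (hM : OK M) :
    ∃ (hr : M.length ≤ r + 1) (ht : M.length ≤ t + 1) (D : DElt (r + 1) (t + 1) M.length),
      (M.map (fun p => (D.pr p.1, D.pt p.2))).Perm (diag r t M.length hr ht) := by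
  have hp := List.mergeSort_perm M (fun p q => decide (p.1 ≤ q.1))
  have hsort := List.pairwise_mergeSort (le := fun p q : Fin (r + 1) × Fin (t + 1) =>
    decide (p.1 ≤ q.1)) (by intro a b c; simp; exact le_trans) (by intro a b; simp; exact le_total _ _) M
  have hO := OK_perm hp.symm hM
  have hlen := hp.length_eq
  generalize M.mergeSort (fun p q => decide (p.1 ≤ q.1)) = M' at *
  suffices h : ∃ (hr : M'.length ≤ r + 1) (ht : M'.length ≤ t + 1)
      (D : DElt (r + 1) (t + 1) M'.length),
      (M'.map (fun p => (D.pr p.1, D.pt p.2))) = (diag r t M'.length hr ht) by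
    rw [← hlen]
    obtain ⟨hr, ht, D, h⟩ := h
    refine ⟨hr, ht, D, ?_⟩
    rw [← h]
    exact (hp.symm.map _)
  rw [OK, List.pairwise_iff_getElem] at hO
  rw [List.pairwise_iff_getElem] at hsort
  have hI : StrictMono (fun k : Fin M'.length => M'[k].1) := by
    intro a b hab
    refine lt_of_le_of_ne ?_ (hO a b a.2 b.2 hab).1
    simpa using hsort a b a.2 b.2 hab
  have hJ : Function.Injective (fun k : Fin M'.length => M'[k].2) := by
    intro a b hab
    by_contra hne
    rcases lt_or_gt_of_ne hne with h | h
    · exact (hO a b a.2 b.2 h).2 hab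
    · exact (hO b a b.2 a.2 h).2 hab.symm
  obtain ⟨a, a1, a2, a3, a4⟩ := exists_b (r + 1) _ _ hI.injective
  obtain ⟨b, b1, b2, b3, -⟩ := exists_b (t + 1) _ _ hJ
  have hr := Fintype.card_le_of_injective _ hI.injective
  have ht := Fintype.card_le_of_injective _ hJ
  simp only [Fintype.card_fin] at hr ht
  refine ⟨hr, ht, ⟨a, b, ?_, ?_, a2, b1, b2⟩, ?_⟩
  · intro i j hij
    rw [(a4 hI).1, (a4 hI).1]
    have := hI hij
    simpa using this
  · intro k; have := a1 k; omega
  · apply List.ext_getElem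
    · simp [diag]
    · intro i h1 h2
      simp only [List.getElem_map, diag, List.getElem_finRange]
      have hi : i < M'.length := by simpa using h1
      have e1 := a3 ⟨i, hi⟩
      have e2 := b3 ⟨i, hi⟩
      refine Prod.ext (Fin.ext ?_) (Fin.ext ?_)
      · exact e1
      · exact e2

theorem EM_swap (N : List (Fin (r + 1) × Fin (t + 1))) (hN : OK N) (p q) (hp : p ∈ N) (hq : q ∈ N)
    (hpq : p ≠ q) : d.EM N * d.ρ (Equiv.swap p.1 q.1, Equiv.swap p.2 q.2) = d.EM N := by
  have h1 := List.perm_cons_erase hp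
  have hq' : q ∈ N.erase p := by
    rw [List.mem_erase_of_ne hpq.symm]; exact hq
  have h2 := List.perm_cons_erase hq'
  have h3 : N.Perm ((N.erase p).erase q ++ [p, q]) :=
    (h1.trans (h2.cons p)).trans (by
      have := List.perm_append_comm (l₁ := [p, q]) (l₂ := (N.erase p).erase q)
      simpa using this)
  have hne := OK_ne hN hp hq hpq
  rw [d.EM_perm h3 hN]
  generalize (N.erase p).erase q = N'
  have : d.EM (N' ++ [p, q]) = d.EM N' * (d.EE p.1 p.2 * d.EE q.1 q.2) := by simp [EM]
  rw [this, mul_assoc, d.EE_EE_swap _ _ _ _ hne.1 hne.2]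

theorem fix_all (N : List (Fin (r + 1) × Fin (t + 1))) (hN : OK N) (h : Gp r t)
    (hh : ∀ p ∈ N, (h.1 p.1, h.2 p.2) ∈ N) (L : List (Fin (r + 1) × Fin (t + 1)))
    (hL : ∀ p ∈ L, p ∈ N) : ∃ w : Gp r t, d.EM N * d.ρ h = d.EM N * d.ρ w ∧
      (∀ p ∈ N, (w.1 p.1, w.2 p.2) ∈ N) ∧ (∀ p ∈ L, (w.1 p.1, w.2 p.2) = p) := by
  induction L with
  | nil => exact ⟨h, rfl, hh, by simp⟩
  | cons p L ih =>
    obtain ⟨w, h1, h2, h3⟩ := ih (fun q hq => hL q (by simp [hq]))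
    have hp := hL p (by simp)
    by_cases hw : (w.1 p.1, w.2 p.2) = p
    · refine ⟨w, h1, h2, ?_⟩
      intro q hq
      rcases List.mem_cons.1 hq with rfl | hq
      · exact hw
      · exact h3 q hq
    · obtain ⟨q, hqe⟩ : ∃ q, q = (w.1 p.1, w.2 p.2) := ⟨_, rfl⟩
      have hq : q ∈ N := hqe ▸ h2 p hp
      have hpq : p ≠ q := fun h => hw (by rw [← hqe]; exact h.symm)
      have hfix : ∀ s ∈ N, s ≠ p → s ≠ q →
          (Equiv.swap p.1 q.1 s.1, Equiv.swap p.2 q.2 s.2) = s := by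
        intro s hs hsp hsq
        have a1 := OK_ne hN hs hp hsp
        have a2 := OK_ne hN hs hq hsq
        rw [Equiv.swap_apply_of_ne_of_ne a1.1 a2.1, Equiv.swap_apply_of_ne_of_ne a1.2 a2.2]
      refine ⟨(Equiv.swap p.1 q.1, Equiv.swap p.2 q.2) * w, ?_, ?_, ?_⟩
      · rw [map_mul, ← mul_assoc, d.EM_swap N hN p q hp hq hpq, h1]
      · intro s hs
        have h4 := h2 s hs
        simp only [Prod.fst_mul, Prod.snd_mul, Equiv.Perm.mul_apply]
        generalize hu : (w.1 s.1, w.2 s.2) = u at h4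
        have hu1 := congrArg Prod.fst hu
        have hu2 := congrArg Prod.snd hu
        simp only at hu1 hu2
        rw [hu1, hu2]
        by_cases up : u = p
        · rw [up]; simpa using hq
        by_cases uq : u = q
        · rw [uq]; simpa using hp
        rw [hfix u h4 up uq]; exact h4
      · intro s hs
        simp only [Prod.fst_mul, Prod.snd_mul, Equiv.Perm.mul_apply]
        rcases List.mem_cons.1 hs with rfl | hs
        · rw [Prod.ext_iff] at hqe
          simp only at hqe
          rw [← hqe.1, ← hqe.2]; simp
        · have h4 := h3 s hs
          have hsp : s ≠ p := by rintro rfl; exact hw h4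
          have hsq : s ≠ q := by
            rintro rfl
            apply hsp
            rw [hqe] at h4
            have e1 := w.1.injective (congrArg Prod.fst h4)
            have e2 := w.2.injective (congrArg Prod.snd h4)
            rw [hqe]
            exact Prod.ext e1 e2
          have h5 := hfix s (hL s (by simp [hs])) hsp hsq
          have hu1 := congrArg Prod.fst h4
          have hu2 := congrArg Prod.snd h4
          simp only at hu1 hu2
          rw [hu1, hu2]; exact h5

theorem OK_diag (f hr ht) : OK (diag r t f hr ht) := by
  rw [OK, diag, List.pairwise_map]
  refine List.Pairwise.imp ?_ (List.nodup_finRange f)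
  intro a b hab
  simp [Fin.ext_iff] at *
  exact hab

theorem mem_diag (f hr ht) (p : Fin (r + 1) × Fin (t + 1)) :
    p ∈ diag r t f hr ht ↔ (p.1 : ℕ) < f ∧ (p.1 : ℕ) = p.2 := by
  simp only [diag, List.mem_map, List.mem_finRange, true_and]
  constructor
  · rintro ⟨k, rfl⟩; simp
  · rintro ⟨h1, h2⟩
    exact ⟨⟨p.1, h1⟩, Prod.ext (Fin.ext rfl) (Fin.ext h2)⟩

/-- the normal form of group-like elements -/
theorem EM_normal (M : List (Fin (r + 1) × Fin (t + 1))) (hM : OK M) (g : Gp r t) :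
    ∃ (f : ℕ) (_ : f ≤ min (r + 1) (t + 1)) (d1 d2 : DElt (r + 1) (t + 1) f)
      (w : Equiv.Perm (Fin (r + 1))) (wb : Equiv.Perm (Fin (t + 1))),
      (∀ i : Fin (r + 1), (i : ℕ) < f → w i = i) ∧ (∀ j : Fin (t + 1), (j : ℕ) < f → wb j = j) ∧
      d.EM M * d.ρ g = d.σ (d1.pr⁻¹) * d.σb (d1.pt⁻¹) * d.epow f *
        d.σ w * d.σb wb * d.σ d2.pr * d.σb d2.pt := by
  obtain ⟨hr, ht, D1, h1⟩ := exists_D M hM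
  have hM2 := OK_map g⁻¹ hM
  have hD2 := exists_D _ hM2
  rw [List.length_map] at hD2
  obtain ⟨hr', ht', D2, h2⟩ := hD2
  set N := diag r t M.length hr ht with hN
  have hON : OK N := OK_diag _ _ _
  let g1 : Gp r t := (D1.pr, D1.pt)
  let g2 : Gp r t := (D2.pr, D2.pt)
  obtain ⟨w, w1, -, w3⟩ := d.fix_all N hON (g1 * g * g2⁻¹) (by
    intro p hp
    have hp' := h2.mem_iff.2 hp
    rw [List.map_map, List.mem_map] at hp'
    obtain ⟨q, hq, rfl⟩ := hp'
    rw [← h1.mem_iff, List.mem_map]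
    exact ⟨q, hq, by simp [g1, g2]⟩) N (fun _ h => h)
  refine ⟨M.length, by simp; omega, D1, D2, w.1, w.2, ?_, ?_, ?_⟩
  · intro i hi
    have h := w3 (i, ⟨i, by omega⟩) ((mem_diag _ _ _ _).2 ⟨hi, rfl⟩)
    exact congrArg Prod.fst h
  · intro j hj
    have h := w3 (⟨j, by omega⟩, j) ((mem_diag _ _ _ _).2 ⟨hj, rfl⟩)
    exact congrArg Prod.snd h
  · have hs := d.semi_EM g1 M
    have e1 : d.EM (M.map (fun p => (g1.1 p.1, g1.2 p.2))) = d.EM N :=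
      d.EM_perm h1 (OK_map g1 hM)
    rw [e1] at hs
    have e2 : d.EM M = d.ρ g1⁻¹ * (d.EM N * d.ρ g1) := by
      rw [← hs, ← mul_assoc, ρ_inv_mul, one_mul]
    have e3 : d.ρ g1 * d.ρ g = d.ρ (g1 * g * g2⁻¹) * d.ρ g2 := by
      rw [← map_mul, ← map_mul]; simp
    rw [d.epow_eq _ hr ht, e2, mul_assoc, mul_assoc, e3, ← mul_assoc (d.EM N), w1]
    rw [ρ_def, ρ_def, ρ_def]
    simp only [mul_assoc, g1, g2, Prod.inv_mk]
    rfl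

end GData

namespace GData
variable {R B : Type} [CommRing R] [Ring B] [Algebra R B] {r t : ℕ} (d : GData R B r t)

/-- graded `x^α` -/
def gx (α : Fin (r + 1) → ℕ) : B :=
  ((List.finRange (r + 1)).map (fun i => d.Lt false (.inl i) ^ α i)).prod
/-- graded `x̄^β` -/
def gxb (β : Fin (t + 1) → ℕ) : B :=
  ((List.finRange (t + 1)).map (fun i => d.Lt false (.inr i) ^ β i)).prod
/-- graded regular monomial -/
def gmon (s : SIndex (r + 1) (t + 1)) : B := d.gx s.α * d.basElt s.dIdx * d.gxb s.β

theorem flip_c {n : ℕ} (y : Fin n → B) (hc : ∀ j k, SE (y j * y k) (y k * y j))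
    (hy : ∀ i, SE (y i * y i) 1) (γ : Fin n → Fin 2) (i : Fin n) : ∃ γ' : Fin n → Fin 2,
    SE (y i * ((List.finRange n).map (fun j => y j ^ (γ j : ℕ))).prod)
      ((List.finRange n).map (fun j => y j ^ (γ' j : ℕ))).prod := by
  refine ⟨Function.update γ i (γ i + 1), ?_⟩
  refine SE.insert_prod y (fun j => (γ j : ℕ))
    (fun j => ((Function.update γ i (γ i + 1) j : Fin 2) : ℕ)) i hc ?_ ?_ _
    (List.nodup_finRange n) (by simp)
  · rw [Function.update_self]
    generalize γ i = a
    fin_cases a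
    · simpa using SE.refl (y i)
    · simpa using hy i
  · intro j hj
    rw [Function.update_of_ne hj]

theorem add_x {n : ℕ} (y : Fin n → B) (hc : ∀ j k, SE (y j * y k) (y k * y j))
    (α : Fin n → ℕ) (i : Fin n) : ∃ α' : Fin n → ℕ,
    SE (y i * ((List.finRange n).map (fun j => y j ^ (α j : ℕ))).prod)
      ((List.finRange n).map (fun j => y j ^ (α' j : ℕ))).prod := by
  refine ⟨Function.update α i (α i + 1), ?_⟩
  refine SE.insert_prod y α _ i hc ?_ ?_ _ (List.nodup_finRange n) (by simp)
  · rw [Function.update_self, ← pow_succ']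
    exact SE.refl _
  · intro j hj
    rw [Function.update_of_ne hj]

theorem list_pow_comm {n : ℕ} (a : B) (y : Fin n → B) (h : ∀ i, SE (a * y i) (y i * a))
    (α : Fin n → ℕ) : SE (a * ((List.finRange n).map (fun j => y j ^ (α j : ℕ))).prod)
      (((List.finRange n).map (fun j => y j ^ (α j : ℕ))).prod * a) :=
  SE.comm_list _ _ (fun i _ => (h i).comm_pow _)

theorem W_normal (τ : List (Bool × Fin (r + 1))) : ∃ α γ, SE (d.W τ) (d.gx α * d.cpow γ) := by
  induction τ with
  | nil => exact ⟨0, 0, by simpa [W, gx, WBC.cpow] using SE.refl (1 : B)⟩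
  | cons p τ ih =>
    obtain ⟨b, i⟩ := p
    obtain ⟨α, γ, h⟩ := ih
    rw [W_cons]
    have h1 := h.mul_left (d.Lt b (.inl i))
    cases b
    · obtain ⟨α', h'⟩ := add_x (fun i => d.Lt false (.inl i)) (fun _ _ => d.Lt_comm _ _ _ _) α i
      refine ⟨α', γ, h1.trans ?_⟩
      rw [← mul_assoc]
      exact h'.mul_right _
    · obtain ⟨γ', h'⟩ := flip_c (fun i => d.Lt true (.inl i)) (fun _ _ => d.Lt_comm _ _ _ _)
        (fun i => .of_neg (d.c_sq i)) γ i
      refine ⟨α, γ', h1.trans ?_⟩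
      have h2 := (list_pow_comm (d.Lt true (.inl i)) (fun i => d.Lt false (.inl i))
        (fun _ => d.Lt_comm _ _ _ _) α).mul_right (d.cpow γ)
      rw [← mul_assoc]
      refine SE.trans h2 ?_
      rw [mul_assoc]
      exact h'.mul_left _

theorem Wb_normal (τ : List (Bool × Fin (t + 1))) :
    ∃ γ β, SE (d.Wb τ) (d.cbpow γ * d.gxb β) := by
  induction τ with
  | nil => exact ⟨0, 0, by simpa [Wb, gxb, WBC.cbpow] using SE.refl (1 : B)⟩
  | cons p τ ih =>
    obtain ⟨b, i⟩ := p
    obtain ⟨γ, α, h⟩ := ih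
    rw [Wb_cons]
    have h1 := h.mul_left (d.Lt b (.inr i))
    cases b
    · obtain ⟨α', h'⟩ := add_x (fun i => d.Lt false (.inr i)) (fun _ _ => d.Lt_comm _ _ _ _) α i
      refine ⟨γ, α', h1.trans ?_⟩
      have h2 := (list_pow_comm (d.Lt false (.inr i)) (fun i => d.Lt true (.inr i))
        (fun _ => d.Lt_comm _ _ _ _) (fun j => (γ j : ℕ))).mul_right (d.gxb α)
      rw [← mul_assoc]
      refine SE.trans h2 ?_
      rw [mul_assoc]
      exact h'.mul_left _
    · obtain ⟨γ', h'⟩ := flip_c (fun i => d.Lt true (.inr i)) (fun _ _ => d.Lt_comm _ _ _ _)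
        (fun i => .of_eq (d.cb_sq i)) γ i
      refine ⟨γ', α, h1.trans ?_⟩
      rw [← mul_assoc]
      exact h'.mul_right _

theorem K_le : d.K ≤ Submodule.span R (Set.range d.gmon) := by
  rw [K, Submodule.span_le]
  rintro _ ⟨τ, M, g, τb, hM, rfl⟩
  obtain ⟨α, γ, h1⟩ := d.W_normal τ
  obtain ⟨δ, β, h2⟩ := d.Wb_normal τb
  obtain ⟨f, hf, d1, d2, w, wb, hw, hwb, h3⟩ := d.EM_normal M hM g
  have h4 : SE (d.mon τ M g τb) (d.gmon ⟨α, β, ⟨γ, δ, f, hf, d1, d2, w, wb, hw, hwb⟩⟩) := by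
    have h5 := h1.mul ((SE.refl (d.EM M * d.ρ g)).mul h2)
    rw [mon, gmon, WBC.basElt]
    rw [h3] at h5
    rw [← mul_assoc (d.EM M), h3]
    refine h5.trans (.of_eq ?_)
    simp only [mul_assoc]
  exact h4.mem (Submodule.subset_span ⟨_, rfl⟩)

end GData

/-! ### Filtered algebras and their associated graded algebras -/

/-- An exhaustive-from-below filtration of an algebra. -/
structure Filt (R A : Type) [CommRing R] [Ring A] [Algebra R A] : Type where
  F : ℕ → Submodule R A
  mono : Monotone F
  one_mem : (1 : A) ∈ F 0
  mul_mem : ∀ m n a b, a ∈ F m → b ∈ F n → a * b ∈ F (m + n)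

namespace Filt
variable {R A : Type} [CommRing R] [Ring A] [Algebra R A] (Φ : Filt R A)

/-- the previous step of the filtration -/
def Fl : ℕ → Submodule R A
  | 0 => ⊥
  | n + 1 => Φ.F n

theorem Fl_le (n : ℕ) : Φ.Fl n ≤ Φ.F n := by
  cases n with
  | zero => exact bot_le
  | succ n => exact Φ.mono (Nat.le_succ n)

theorem Fl_mul_left {m n a b} (ha : a ∈ Φ.F m) (hb : b ∈ Φ.Fl n) : a * b ∈ Φ.Fl (m + n) := by
  cases n with
  | zero =>
    have : b = 0 := by simpa [Fl] using hb
    rw [this, mul_zero]; exact zero_mem _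
  | succ n => exact Φ.mul_mem m n a b ha hb

theorem Fl_mul_right {m n a b} (ha : a ∈ Φ.Fl m) (hb : b ∈ Φ.F n) : a * b ∈ Φ.Fl (m + n) := by
  cases m with
  | zero =>
    have : a = 0 := by simpa [Fl] using ha
    rw [this, zero_mul]; exact zero_mem _
  | succ m =>
    have := Φ.mul_mem m n a b ha hb
    rw [show m + 1 + n = m + n + 1 by omega]
    exact this

/-- the Rees algebra -/
def Rees : Subalgebra R (Polynomial A) where
  carrier := {p | ∀ n, p.coeff n ∈ Φ.F n}
  mul_mem' := by
    intro p q hp hq n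
    rw [Polynomial.coeff_mul]
    refine Submodule.sum_mem _ (fun x hx => ?_)
    rw [← Finset.HasAntidiagonal.mem_antidiagonal.1 hx]
    exact Φ.mul_mem _ _ _ _ (hp _) (hq _)
  add_mem' := by
    intro p q hp hq n
    rw [Polynomial.coeff_add]
    exact add_mem (hp n) (hq n)
  algebraMap_mem' := by
    intro c n
    rw [Polynomial.algebraMap_apply, Polynomial.coeff_C]
    split_ifs with h
    · subst h
      rw [Algebra.algebraMap_eq_smul_one]
      exact Submodule.smul_mem _ _ Φ.one_mem
    · exact zero_mem _

theorem mem_Rees (p : Polynomial A) : p ∈ Φ.Rees ↔ ∀ n, p.coeff n ∈ Φ.F n := Iff.rfl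

/-- the ideal of lower terms -/
def I : Ideal Φ.Rees where
  carrier := {p | ∀ n, (p : Polynomial A).coeff n ∈ Φ.Fl n}
  zero_mem' := by intro n; simp
  add_mem' := by
    intro p q hp hq n
    have : ((p + q : Φ.Rees) : Polynomial A).coeff n
      = (p : Polynomial A).coeff n + (q : Polynomial A).coeff n := by simp
    rw [this]
    exact add_mem (hp n) (hq n)
  smul_mem' := by
    intro p q hq n
    have : ((p • q : Φ.Rees) : Polynomial A) = (p : Polynomial A) * (q : Polynomial A) := rfl
    rw [this, Polynomial.coeff_mul]
    refine Submodule.sum_mem _ (fun x hx => ?_)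
    rw [← Finset.HasAntidiagonal.mem_antidiagonal.1 hx]
    exact Φ.Fl_mul_left (p.2 _) (hq _)

theorem mem_I (p : Φ.Rees) : p ∈ Φ.I ↔ ∀ n, (p : Polynomial A).coeff n ∈ Φ.Fl n := Iff.rfl

instance : Φ.I.IsTwoSided := ⟨by
  intro p q hp n
  have : ((p * q : Φ.Rees) : Polynomial A) = (p : Polynomial A) * (q : Polynomial A) := rfl
  rw [this, Polynomial.coeff_mul]
  refine Submodule.sum_mem _ (fun x hx => ?_)
  rw [← Finset.HasAntidiagonal.mem_antidiagonal.1 hx]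
  exact Φ.Fl_mul_right (hp _) (q.2 _)⟩

/-- the associated graded algebra -/
abbrev gr : Type := Φ.Rees ⧸ Φ.I

theorem mono_mem {n : ℕ} {a : A} (ha : a ∈ Φ.F n) : Polynomial.monomial n a ∈ Φ.Rees := by
  intro k
  rw [Polynomial.coeff_monomial]
  split_ifs with h
  · exact h ▸ ha
  · exact zero_mem _

/-- leading class -/
def cl (n : ℕ) (a : A) (ha : a ∈ Φ.F n) : Φ.gr :=
  Ideal.Quotient.mk Φ.I ⟨Polynomial.monomial n a, Φ.mono_mem ha⟩

/-- `z` is the class of `a` in degree `n` -/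
def Rep (n : ℕ) (a : A) (z : Φ.gr) : Prop := ∃ ha : a ∈ Φ.F n, Φ.cl n a ha = z

variable {Φ}

theorem rep (n : ℕ) {a : A} (ha : a ∈ Φ.F n) : Φ.Rep n a (Φ.cl n a ha) := ⟨ha, rfl⟩

namespace Rep

theorem cast {n m a z} (h : Φ.Rep n a z) (hm : n = m) : Φ.Rep m a z := hm ▸ h

theorem mul {n m a b z w} (h : Φ.Rep n a z) (h' : Φ.Rep m b w) : Φ.Rep (n + m) (a * b) (z * w) := by
  obtain ⟨ha, rfl⟩ := h
  obtain ⟨hb, rfl⟩ := h'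
  refine ⟨Φ.mul_mem _ _ _ _ ha hb, ?_⟩
  rw [cl, cl, cl, ← map_mul]
  congr 1
  apply Subtype.ext
  exact (Polynomial.monomial_mul_monomial _ _ _ _).symm

theorem add {n a b z w} (h : Φ.Rep n a z) (h' : Φ.Rep n b w) : Φ.Rep n (a + b) (z + w) := by
  obtain ⟨ha, rfl⟩ := h
  obtain ⟨hb, rfl⟩ := h'
  refine ⟨add_mem ha hb, ?_⟩
  rw [cl, cl, cl, ← map_add]
  congr 1
  apply Subtype.ext
  exact map_add (Polynomial.monomial n) _ _

theorem neg {n a z} (h : Φ.Rep n a z) : Φ.Rep n (-a) (-z) := by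
  obtain ⟨ha, rfl⟩ := h
  refine ⟨neg_mem ha, ?_⟩
  rw [cl, cl, ← map_neg]
  congr 1
  apply Subtype.ext
  exact Polynomial.monomial_neg _ _

theorem sub {n a b z w} (h : Φ.Rep n a z) (h' : Φ.Rep n b w) : Φ.Rep n (a - b) (z - w) := by
  rw [sub_eq_add_neg, sub_eq_add_neg]; exact h.add h'.neg

theorem smul {n a z} (c : R) (h : Φ.Rep n a z) : Φ.Rep n (c • a) (c • z) := by
  obtain ⟨ha, rfl⟩ := h
  refine ⟨Submodule.smul_mem _ c ha, ?_⟩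
  rw [cl, cl]
  have : (c • (Ideal.Quotient.mk Φ.I ⟨Polynomial.monomial n a, Φ.mono_mem ha⟩ : Φ.gr))
    = Ideal.Quotient.mk Φ.I (c • ⟨Polynomial.monomial n a, Φ.mono_mem ha⟩) := rfl
  rw [this]
  congr 1
  apply Subtype.ext
  exact (Polynomial.smul_monomial _ _ _).symm

theorem one : Φ.Rep 0 1 1 := by
  refine ⟨Φ.one_mem, ?_⟩
  rw [cl, ← map_one (Ideal.Quotient.mk Φ.I)]
  congr 1

theorem zero_of {n a} (h : a ∈ Φ.Fl n) : Φ.Rep n a 0 := by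
  refine ⟨Φ.Fl_le n h, ?_⟩
  rw [cl, Ideal.Quotient.eq_zero_iff_mem, mem_I]
  intro k
  simp only [Polynomial.coeff_monomial]
  split_ifs with hk
  · exact hk ▸ h
  · exact zero_mem _

theorem uniq {n a z w} (h : Φ.Rep n a z) (h' : Φ.Rep n a w) : z = w := by
  obtain ⟨ha, rfl⟩ := h
  obtain ⟨hb, rfl⟩ := h'
  rfl

theorem congr {n a b z} (h : Φ.Rep n a z) (hab : b - a ∈ Φ.Fl n) : Φ.Rep n b z := by
  have := (zero_of hab).add h
  simpa using this

theorem eq {n a b z w} (h : Φ.Rep n a z) (h' : Φ.Rep n b w) (hab : b - a ∈ Φ.Fl n) : z = w :=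
  (h.congr hab).uniq h'

theorem eq' {n a b z w} (h : Φ.Rep n a z) (h' : Φ.Rep n b w) (hab : a = b) : z = w := by
  subst hab; exact h.uniq h'

theorem pow {n a z} (h : Φ.Rep n a z) (k : ℕ) : Φ.Rep (k * n) (a ^ k) (z ^ k) := by
  induction k with
  | zero => simpa using one
  | succ k ih =>
    rw [pow_succ, pow_succ]
    exact (ih.mul h).cast (by ring)

theorem pow1 {a z} (h : Φ.Rep 1 a z) (k : ℕ) : Φ.Rep k (a ^ k) (z ^ k) :=
  (h.pow k).cast (by ring)

theorem list {ι : Type} (l : List ι) (n : ι → ℕ) (a : ι → A) (z : ι → Φ.gr)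
    (h : ∀ i, Φ.Rep (n i) (a i) (z i)) :
    Φ.Rep (l.map n).sum (l.map a).prod (l.map z).prod := by
  induction l with
  | nil => simpa using one
  | cons i l ih => simpa using (h i).mul ih

end Rep

/-- the degree zero part -/
def F0 (Φ : Filt R A) : Subalgebra R A where
  carrier := Φ.F 0
  mul_mem' := fun {a b} ha hb => Φ.mul_mem 0 0 a b ha hb
  add_mem' := fun {a b} ha hb => (Φ.F 0).add_mem ha hb
  algebraMap_mem' := fun c => by
    rw [Algebra.algebraMap_eq_smul_one]
    exact Submodule.smul_mem _ _ Φ.one_mem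

/-- the degree zero part maps to the associated graded algebra -/
def φ0 (Φ : Filt R A) : Φ.F0 →ₐ[R] Φ.gr :=
  AlgHom.ofLinearMap
    { toFun := fun a => Φ.cl 0 a.1 a.2
      map_add' := fun a b => Rep.uniq (rep 0 (a + b).2) ((rep 0 a.2).add (rep 0 b.2))
      map_smul' := fun c a => Rep.uniq (rep 0 (c • a).2) ((rep 0 a.2).smul c) }
    (Rep.uniq (rep 0 Φ.one_mem) Rep.one)
    (fun a b => Rep.uniq (rep 0 (a * b).2) ((rep 0 a.2).mul (rep 0 b.2)))

theorem φ0_rep (a : Φ.F0) : Φ.Rep 0 a.1 (Φ.φ0 a) := rep 0 a.2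

theorem extract {ι : Type} (m : ι → A) (deg : ι → ℕ) (z : ι → Φ.gr)
    (hm : ∀ i, Φ.Rep (deg i) (m i) (z i)) {n a y} (hy : Φ.Rep n a y)
    (h : y ∈ Submodule.span R (Set.range z)) :
    a ∈ Submodule.span R (Set.range m) ⊔ Φ.Fl n := by
  have key : ∃ p : Φ.Rees, Ideal.Quotient.mk Φ.I p = y ∧
      ∀ k, (p : Polynomial A).coeff k ∈ Submodule.span R (Set.range m) := by
    clear hy
    induction h using Submodule.span_induction with
    | mem x hx =>
      obtain ⟨i, rfl⟩ := hx
      obtain ⟨ha, h⟩ := hm i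
      refine ⟨_, h, ?_⟩
      intro k
      simp only [Polynomial.coeff_monomial]
      split_ifs
      · exact Submodule.subset_span ⟨i, rfl⟩
      · exact zero_mem _
    | zero => exact ⟨0, map_zero _, fun k => by simp⟩
    | add x x' _ _ h1 h2 =>
      obtain ⟨p, hp, hp'⟩ := h1
      obtain ⟨q, hq, hq'⟩ := h2
      refine ⟨p + q, by rw [map_add, hp, hq], fun k => ?_⟩
      simpa using add_mem (hp' k) (hq' k)
    | smul c x _ h1 =>
      obtain ⟨p, hp, hp'⟩ := h1
      refine ⟨c • p, by rw [← hp]; rfl, fun k => ?_⟩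
      simpa using Submodule.smul_mem _ c (hp' k)
  obtain ⟨p, hp, hp'⟩ := key
  obtain ⟨ha, hy⟩ := hy
  rw [← hp, cl, Ideal.Quotient.eq, mem_I] at hy
  have := hy n
  simp only [AddSubgroupClass.coe_sub, Polynomial.coeff_sub, Polynomial.coeff_monomial,
    if_true] at this
  have e : a = (p : Polynomial A).coeff n + (a - (p : Polynomial A).coeff n) := by abel
  rw [e]
  exact Submodule.add_mem_sup (hp' n) this

end Filt

/-! ### Functoriality of the data -/

section functor
variable {R A B : Type} [CommRing R] [Ring A] [Algebra R A] [Ring B] [Algebra R B] {r t : ℕ}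

/-- push data forward along an algebra homomorphism -/
def WBC.map (d : WBC R A r t) (φ : A →ₐ[R] B) : WBC R B r t where
  σ := (φ : A →* B).comp d.σ
  σb := (φ : A →* B).comp d.σb
  c i := φ (d.c i)
  cb i := φ (d.cb i)
  e := φ d.e
  c_sq i := by simpa using congrArg φ (d.c_sq i)
  c_anti i j h := by simpa using congrArg φ (d.c_anti i j h)
  c_conj w i := by simpa using congrArg φ (d.c_conj w i)
  cb_sq i := by simpa using congrArg φ (d.cb_sq i)
  cb_anti i j h := by simpa using congrArg φ (d.cb_anti i j h)
  cb_conj w i := by simpa using congrArg φ (d.cb_conj w i)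
  comm_σσb w v := by simpa using congrArg φ (d.comm_σσb w v)
  comm_σcb w v := by simpa using congrArg φ (d.comm_σcb w v)
  comm_σbc w v := by simpa using congrArg φ (d.comm_σbc w v)
  anti_ccb w v := by simpa using congrArg φ (d.anti_ccb w v)
  e_c1 h1 h2 := by simpa using congrArg φ (d.e_c1 h1 h2)
  c1_e h1 h2 := by simpa using congrArg φ (d.c1_e h1 h2)
  e_sq := by simpa using congrArg φ d.e_sq
  e_s_e h := by simpa using congrArg φ (d.e_s_e h)
  e_sb_e h := by simpa using congrArg φ (d.e_sb_e h)
  s_e_comm i h h' := by simpa using congrArg φ (d.s_e_comm i h h')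
  sb_e_comm i h h' := by simpa using congrArg φ (d.sb_e_comm i h h')
  braid1 h h' := by simpa using congrArg φ (d.braid1 h h')
  braid2 h h' := by simpa using congrArg φ (d.braid2 h h')
  c_e_comm i h := by simpa using congrArg φ (d.c_e_comm i h)
  cb_e_comm i h := by simpa using congrArg φ (d.cb_e_comm i h)
  e_c_e h := by simpa using congrArg φ (d.e_c_e h)
  e_cb_e h := by simpa using congrArg φ (d.e_cb_e h)

theorem WBC.map_hom (d : WBC R A r t) (φ : A →ₐ[R] B) : WBCHom d (d.map φ) φ :=
  ⟨fun _ => rfl, fun _ => rfl, fun _ => rfl, fun _ => rfl, rfl⟩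

/-- all the generators lie in the subalgebra `S` -/
structure WBC.InS (d : WBC R A r t) (S : Subalgebra R A) : Prop where
  σ : ∀ w, d.σ w ∈ S
  σb : ∀ w, d.σb w ∈ S
  c : ∀ i, d.c i ∈ S
  cb : ∀ i, d.cb i ∈ S
  e : d.e ∈ S

/-- restrict data to a subalgebra -/
def WBC.restrict (d : WBC R A r t) (S : Subalgebra R A) (h : d.InS S) : WBC R S r t where
  σ := { toFun := fun w => ⟨d.σ w, h.σ w⟩
         map_one' := Subtype.ext (map_one d.σ)
         map_mul' := fun v w => Subtype.ext (map_mul d.σ v w) }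
  σb := { toFun := fun w => ⟨d.σb w, h.σb w⟩
          map_one' := Subtype.ext (map_one d.σb)
          map_mul' := fun v w => Subtype.ext (map_mul d.σb v w) }
  c i := ⟨d.c i, h.c i⟩
  cb i := ⟨d.cb i, h.cb i⟩
  e := ⟨d.e, h.e⟩
  c_sq i := Subtype.ext (d.c_sq i)
  c_anti i j h := Subtype.ext (d.c_anti i j h)
  c_conj w i := Subtype.ext (d.c_conj w i)
  cb_sq i := Subtype.ext (d.cb_sq i)
  cb_anti i j h := Subtype.ext (d.cb_anti i j h)
  cb_conj w i := Subtype.ext (d.cb_conj w i)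
  comm_σσb w v := Subtype.ext (d.comm_σσb w v)
  comm_σcb w v := Subtype.ext (d.comm_σcb w v)
  comm_σbc w v := Subtype.ext (d.comm_σbc w v)
  anti_ccb w v := Subtype.ext (d.anti_ccb w v)
  e_c1 h1 h2 := Subtype.ext (d.e_c1 h1 h2)
  c1_e h1 h2 := Subtype.ext (d.c1_e h1 h2)
  e_sq := Subtype.ext d.e_sq
  e_s_e h := Subtype.ext (d.e_s_e h)
  e_sb_e h := Subtype.ext (d.e_sb_e h)
  s_e_comm i h h' := Subtype.ext (d.s_e_comm i h h')
  sb_e_comm i h h' := Subtype.ext (d.sb_e_comm i h h')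
  braid1 h h' := Subtype.ext (d.braid1 h h')
  braid2 h h' := Subtype.ext (d.braid2 h h')
  c_e_comm i h := Subtype.ext (d.c_e_comm i h)
  cb_e_comm i h := Subtype.ext (d.cb_e_comm i h)
  e_c_e h := Subtype.ext (d.e_c_e h)
  e_cb_e h := Subtype.ext (d.e_cb_e h)

theorem WBC.restrict_hom (d : WBC R A r t) (S : Subalgebra R A) (h : d.InS S) :
    WBCHom (d.restrict S h) d S.val :=
  ⟨fun _ => rfl, fun _ => rfl, fun _ => rfl, fun _ => rfl, rfl⟩

theorem WBCHom.map_basElt {d : WBC R A r t} {d' : WBC R B r t} {φ : A →ₐ[R] B}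
    (h : WBCHom d d' φ) (x : BCIndex r t) : φ (d.basElt x) = d'.basElt x := by
  simp only [WBC.basElt, WBC.cpow, WBC.cbpow, WBC.epow, WBC.E, WBC.tr, WBC.trb, map_mul,
    map_list_prod, List.map_map, h.map_σ, h.map_σb]
  congr 1
  · congr 1
    congr 1
    congr 1
    congr 1
    congr 1
    · congr 1
      congr 1
      congr 1
      apply List.map_congr_left
      intro i _
      simp [h.map_c]
    · congr 1
      apply List.map_congr_left
      intro i _
      simp [h.map_σ, h.map_σb, h.map_e]
  · congr 1
    apply List.map_congr_left
    intro i _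
    simp [h.map_cb]

/-- all the generators lie in the subalgebra `S` -/
structure AWBC.InS {ω1 : R} (d : AWBC R A r t ω1) (S : Subalgebra R A) : Prop where
  w : d.toWBC.InS S
  x1 : d.x1 ∈ S
  xb1 : d.xb1 ∈ S
  om : ∀ k, d.om k ∈ S
  omb : ∀ k, d.omb k ∈ S

/-- restrict affine data to a subalgebra -/
def AWBC.restrict {ω1 : R} (d : AWBC R A r t ω1) (S : Subalgebra R A) (h : d.InS S) :
    AWBC R S r t ω1 where
  toWBC := d.toWBC.restrict S h.w
  x1 := ⟨d.x1, h.x1⟩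
  xb1 := ⟨d.xb1, h.xb1⟩
  om k := ⟨d.om k, h.om k⟩
  omb k := ⟨d.omb k, h.omb k⟩
  om_one := Subtype.ext d.om_one
  om_even k := Subtype.ext (d.om_even k)
  omb_zero := Subtype.ext d.omb_zero
  om_comm k := by
    obtain ⟨h1, h2, h3, h4, h5, h6, h7, h8, h9⟩ := d.om_comm k
    exact ⟨fun w => Subtype.ext (h1 w), fun w => Subtype.ext (h2 w), fun w => Subtype.ext (h3 w),
      fun w => Subtype.ext (h4 w), Subtype.ext h5, Subtype.ext h6, Subtype.ext h7,
      fun w => Subtype.ext (h8 w), fun w => Subtype.ext (h9 w)⟩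
  omb_comm k := by
    obtain ⟨h1, h2, h3, h4, h5, h6, h7, h8⟩ := d.omb_comm k
    exact ⟨fun w => Subtype.ext (h1 w), fun w => Subtype.ext (h2 w), fun w => Subtype.ext (h3 w),
      fun w => Subtype.ext (h4 w), Subtype.ext h5, Subtype.ext h6, Subtype.ext h7,
      fun w => Subtype.ext (h8 w)⟩
  x_comm h := Subtype.ext (d.x_comm h)
  x1_c1 h := Subtype.ext (d.x1_c1 h)
  x1_c i h := Subtype.ext (d.x1_c i h)
  s_x1 i h h' := Subtype.ext (d.s_x1 i h h')
  xb_comm h := Subtype.ext (d.xb_comm h)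
  xb1_cb1 h := Subtype.ext (d.xb1_cb1 h)
  xb1_cb i h := Subtype.ext (d.xb1_cb i h)
  sb_xb1 i h h' := Subtype.ext (d.sb_xb1 i h h')
  e_xsum := Subtype.ext d.e_xsum
  xsum_e := Subtype.ext d.xsum_e
  e_sxs h := Subtype.ext (d.e_sxs h)
  x_mixed h := Subtype.ext (d.x_mixed h)
  e_sbxbsb h := Subtype.ext (d.e_sbxbsb h)
  e_xodd k := Subtype.ext (by exact (d.e_xodd k))
  e_xeven k h := Subtype.ext (by exact (d.e_xeven k h))
  e_xb k h := Subtype.ext (by exact (d.e_xb k h))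
  x1_cb_comm j := Subtype.ext (d.x1_cb_comm j)
  xb1_c_comm j := Subtype.ext (d.xb1_c_comm j)
  x1_σb j := Subtype.ext (d.x1_σb j)
  xb1_σ j := Subtype.ext (d.xb1_σ j)

theorem AWBC.restrict_spec {ω1 : R} (d : AWBC R A r t ω1) (S : Subalgebra R A) (h : d.InS S)
    {ω : ℕ → R} (hs : d.IsSpec ω) : (d.restrict S h).IsSpec ω :=
  ⟨fun k => Subtype.ext (hs.1 k), fun k hk => Subtype.ext (hs.2 k hk)⟩

theorem AWBC.restrict_cyc {ω1 : R} (d : AWBC R A r t ω1) (S : Subalgebra R A) (h : d.InS S)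
    {f g : Polynomial R} (hs : d.IsCyc f g) : (d.restrict S h).IsCyc f g :=
  ⟨Subtype.ext ((Polynomial.aeval_subalgebra_coe f S (d.restrict S h).x1).symm ▸ hs.1),
    Subtype.ext ((Polynomial.aeval_subalgebra_coe g S (d.restrict S h).xb1).symm ▸ hs.2)⟩

theorem AWBC.all_mem {ω1 : R} (d : AWBC R A r t ω1) (S : Subalgebra R A) (h : d.InS S)
    (h1 : ∃ φ : A →ₐ[R] S, AWBCHom d (d.restrict S h) φ)
    (h2 : ∃! φ : A →ₐ[R] A, AWBCHom d d φ) (a : A) : a ∈ S := by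
  obtain ⟨φ, hφ⟩ := h1
  have e1 : AWBCHom d d (S.val.comp φ) :=
    ⟨fun w => congrArg Subtype.val (hφ.map_σ w),
     fun w => congrArg Subtype.val (hφ.map_σb w),
     fun w => congrArg Subtype.val (hφ.map_c w),
     fun w => congrArg Subtype.val (hφ.map_cb w),
     congrArg Subtype.val (hφ.map_e),
     congrArg Subtype.val (hφ.map_x1),
     congrArg Subtype.val (hφ.map_xb1),
     fun w => congrArg Subtype.val (hφ.map_om w),
     fun w => congrArg Subtype.val (hφ.map_omb w)⟩
  have e2 : AWBCHom d d (AlgHom.id R A) :=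
    ⟨fun _ => rfl, fun _ => rfl, fun _ => rfl, fun _ => rfl, rfl, rfl, rfl, fun _ => rfl,
      fun _ => rfl⟩
  have e3 := h2.unique e1 e2
  have e4 : (φ a : A) = a := by
    simpa using congrArg (fun ψ : A →ₐ[R] A => ψ a) e3
  rw [← e4]
  exact (φ a).2

end functor

/-! ### The word filtration and its graded algebra -/

section words
variable {R A : Type} [CommRing R] [Ring A] [Algebra R A] {r t : ℕ} {ω1 : R}

/-- words in the generators with `n` occurrences of `x_1`, `x̄_1` -/
inductive IsWord (d : AWBC R A (r + 1) (t + 1) ω1) : ℕ → A → Prop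
  | one : IsWord d 0 1
  | σ (w) {n a} : IsWord d n a → IsWord d n (d.σ w * a)
  | σb (w) {n a} : IsWord d n a → IsWord d n (d.σb w * a)
  | c (i) {n a} : IsWord d n a → IsWord d n (d.c i * a)
  | cb (i) {n a} : IsWord d n a → IsWord d n (d.cb i * a)
  | e {n a} : IsWord d n a → IsWord d n (d.e * a)
  | x1 {n a} : IsWord d n a → IsWord d (n + 1) (d.x1 * a)
  | xb1 {n a} : IsWord d n a → IsWord d (n + 1) (d.xb1 * a)

namespace AWBC

variable (d : AWBC R A (r + 1) (t + 1) ω1)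

theorem isWord_mul {m n : ℕ} {a b : A} (ha : IsWord d m a) (hb : IsWord d n b) :
    IsWord d (m + n) (a * b) := by
  induction ha with
  | one => simpa using hb
  | σ w _ ih => rw [mul_assoc]; exact ih.σ w
  | σb w _ ih => rw [mul_assoc]; exact ih.σb w
  | c i _ ih => rw [mul_assoc]; exact ih.c i
  | cb i _ ih => rw [mul_assoc]; exact ih.cb i
  | e _ ih => rw [mul_assoc]; exact ih.e
  | x1 _ ih => rw [mul_assoc, Nat.add_right_comm]; exact ih.x1
  | xb1 _ ih => rw [mul_assoc, Nat.add_right_comm]; exact ih.xb1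

/-- the filtration by the number of `x`'s -/
def wf : Filt R A where
  F n := Submodule.span R {a | ∃ m ≤ n, IsWord d m a}
  mono := fun m n h => Submodule.span_mono (fun a ⟨k, hk, ha⟩ => ⟨k, hk.trans h, ha⟩)
  one_mem := Submodule.subset_span ⟨0, le_rfl, IsWord.one⟩
  mul_mem := by
    intro m n a b ha hb
    have := Submodule.mul_mem_mul ha hb
    rw [Submodule.span_mul_span] at this
    refine Submodule.span_mono ?_ this
    rintro _ ⟨a, ⟨k, hk, ha⟩, b, ⟨l, hl, hb⟩, rfl⟩
    exact ⟨k + l, Nat.add_le_add hk hl, d.isWord_mul ha hb⟩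

theorem wf_F (n : ℕ) : d.wf.F n = Submodule.span R {a | ∃ m ≤ n, IsWord d m a} := rfl

theorem word_mem {n : ℕ} {a : A} (h : IsWord d n a) : a ∈ d.wf.F n :=
  Submodule.subset_span ⟨n, le_rfl, h⟩

theorem σ_mem (w) : d.σ w ∈ d.wf.F 0 := by simpa using d.word_mem (IsWord.one.σ w)
theorem σb_mem (w) : d.σb w ∈ d.wf.F 0 := by simpa using d.word_mem (IsWord.one.σb w)
theorem c_mem (w) : d.c w ∈ d.wf.F 0 := by simpa using d.word_mem (IsWord.one.c w)
theorem cb_mem (w) : d.cb w ∈ d.wf.F 0 := by simpa using d.word_mem (IsWord.one.cb w)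
theorem e_mem : d.e ∈ d.wf.F 0 := by simpa using d.word_mem (IsWord.one.e)
theorem x1_mem : d.x1 ∈ d.wf.F 1 := by simpa using d.word_mem (IsWord.one.x1)
theorem xb1_mem : d.xb1 ∈ d.wf.F 1 := by simpa using d.word_mem (IsWord.one.xb1)

theorem inF0 : d.toWBC.InS d.wf.F0 := ⟨d.σ_mem, d.σb_mem, d.c_mem, d.cb_mem, d.e_mem⟩

/-- union of the filtration -/
def US : Subalgebra R A where
  carrier := {a | ∃ n, a ∈ d.wf.F n}
  mul_mem' := fun ⟨m, ha⟩ ⟨n, hb⟩ => ⟨m + n, d.wf.mul_mem _ _ _ _ ha hb⟩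
  add_mem' := fun ⟨m, ha⟩ ⟨n, hb⟩ => ⟨m + n, add_mem
    (d.wf.mono (Nat.le_add_right m n) ha) (d.wf.mono (Nat.le_add_left n m) hb)⟩
  algebraMap_mem' := fun c => ⟨0, d.wf.F0.algebraMap_mem c⟩

theorem inUS {ω : ℕ → R} (hs : d.IsSpec ω) : d.InS d.US where
  w := ⟨fun w => ⟨0, d.σ_mem w⟩, fun w => ⟨0, d.σb_mem w⟩, fun w => ⟨0, d.c_mem w⟩,
    fun w => ⟨0, d.cb_mem w⟩, ⟨0, d.e_mem⟩⟩
  x1 := ⟨1, d.x1_mem⟩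
  xb1 := ⟨1, d.xb1_mem⟩
  om k := by rw [hs.1 k]; exact d.US.algebraMap_mem _
  omb k := by
    rcases Nat.eq_zero_or_pos k with h | h
    · subst h; rw [d.omb_zero]; exact d.US.zero_mem
    · rw [hs.2 k h]; exact d.US.algebraMap_mem _

/-- the degree zero data on the associated graded algebra -/
def gw : WBC R d.wf.gr (r + 1) (t + 1) := (d.toWBC.restrict d.wf.F0 d.inF0).map d.wf.φ0

theorem rσ (w) : d.wf.Rep 0 (d.σ w) (d.gw.σ w) :=
  Filt.φ0_rep (Φ := d.wf) ⟨d.σ w, d.σ_mem w⟩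
theorem rσb (w) : d.wf.Rep 0 (d.σb w) (d.gw.σb w) :=
  Filt.φ0_rep (Φ := d.wf) ⟨d.σb w, d.σb_mem w⟩
theorem rc (w) : d.wf.Rep 0 (d.c w) (d.gw.c w) :=
  Filt.φ0_rep (Φ := d.wf) ⟨d.c w, d.c_mem w⟩
theorem rcb (w) : d.wf.Rep 0 (d.cb w) (d.gw.cb w) :=
  Filt.φ0_rep (Φ := d.wf) ⟨d.cb w, d.cb_mem w⟩
theorem re : d.wf.Rep 0 (d.e) (d.gw.e) :=
  Filt.φ0_rep (Φ := d.wf) ⟨d.e, d.e_mem⟩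

theorem rbas (x) : d.wf.Rep 0 (d.toWBC.basElt x) (d.gw.basElt x) := by
  have h1 := (WBC.map_hom (d.toWBC.restrict d.wf.F0 d.inF0) d.wf.φ0).map_basElt x
  have h2 := (WBC.restrict_hom d.toWBC d.wf.F0 d.inF0).map_basElt x
  have h3 := Filt.φ0_rep ((d.toWBC.restrict d.wf.F0 d.inF0).basElt x)
  rw [h1] at h3
  change d.wf.F0.val _ = _ at h2
  rw [← h2]
  exact h3

/-- class of `x_1` -/
def gx1 : d.wf.gr := d.wf.cl 1 d.x1 d.x1_mem
/-- class of `x̄_1` -/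
def gxb1 : d.wf.gr := d.wf.cl 1 d.xb1 d.xb1_mem
theorem rx : d.wf.Rep 1 d.x1 d.gx1 := Filt.rep 1 _
theorem rxb : d.wf.Rep 1 d.xb1 d.gxb1 := Filt.rep 1 _

attribute [irreducible] wf gw gx1 gxb1

theorem rsxs (w v) : d.wf.Rep 1 (d.σ w * d.x1 * d.σ v) (d.gw.σ w * d.gx1 * d.gw.σ v) :=
  Filt.Rep.cast (((d.rσ w).mul d.rx).mul (d.rσ v)) rfl
theorem rsbxs (w v) : d.wf.Rep 1 (d.σb w * d.xb1 * d.σb v) (d.gw.σb w * d.gxb1 * d.gw.σb v) :=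
  Filt.Rep.cast (((d.rσb w).mul d.rxb).mul (d.rσb v)) rfl

theorem F0m {a b : A} (ha : a ∈ d.wf.F 0) (hb : b ∈ d.wf.F 0) : a * b ∈ d.wf.F 0 :=
  d.wf.mul_mem 0 0 a b ha hb
theorem F01 {a b : A} (ha : a ∈ d.wf.F 0) (hb : b ∈ d.wf.F 1) : a * b ∈ d.wf.F 1 :=
  d.wf.mul_mem 0 1 a b ha hb
theorem F10 {a b : A} (ha : a ∈ d.wf.F 1) (hb : b ∈ d.wf.F 0) : a * b ∈ d.wf.F 1 :=
  d.wf.mul_mem 1 0 a b ha hb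

theorem g_x_comm (h : 1 < r + 1) :
    d.gx1 * (d.gw.σ (sw (r + 1) 0 1) * d.gx1 * d.gw.σ (sw (r + 1) 0 1))
    = (d.gw.σ (sw (r + 1) 0 1) * d.gx1 * d.gw.σ (sw (r + 1) 0 1)) * d.gx1 := by
  refine (d.rx.mul (d.rsxs _ _)).eq ((d.rsxs _ _).mul d.rx) ?_
  have h1 := d.x_comm h
  rw [mul_sub, sub_mul _ _ d.x1] at h1
  have h2 := sub_eq_sub_iff_sub_eq_sub.1 h1
  rw [← neg_mem_iff, neg_sub, h2]
  have hq : (1 - d.c ⟨0, by omega⟩ * d.c ⟨1, h⟩) * d.σ (sw (r + 1) 0 1) ∈ d.wf.F 0 :=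
    d.F0m (sub_mem d.wf.one_mem (d.F0m (d.c_mem _) (d.c_mem _))) (d.σ_mem _)
  exact sub_mem (d.F10 d.x1_mem hq) (d.F01 hq d.x1_mem)

theorem g_xb_comm (h : 1 < t + 1) :
    d.gxb1 * (d.gw.σb (sw (t + 1) 0 1) * d.gxb1 * d.gw.σb (sw (t + 1) 0 1))
    = (d.gw.σb (sw (t + 1) 0 1) * d.gxb1 * d.gw.σb (sw (t + 1) 0 1)) * d.gxb1 := by
  refine (d.rxb.mul (d.rsbxs _ _)).eq ((d.rsbxs _ _).mul d.rxb) ?_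
  have h1 := d.xb_comm h
  rw [mul_sub, sub_mul _ _ d.xb1] at h1
  have h2 := sub_eq_sub_iff_sub_eq_sub.1 h1
  rw [← neg_mem_iff, neg_sub, h2]
  have hq : (1 + d.cb ⟨0, by omega⟩ * d.cb ⟨1, h⟩) * d.σb (sw (t + 1) 0 1) ∈ d.wf.F 0 :=
    d.F0m (add_mem d.wf.one_mem (d.F0m (d.cb_mem _) (d.cb_mem _))) (d.σb_mem _)
  exact sub_mem (d.F10 d.xb1_mem hq) (d.F01 hq d.xb1_mem)

theorem g_x_xb : d.gx1 * d.gxb1 = d.gxb1 * d.gx1 := by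
  refine (d.rx.mul d.rxb).eq (d.rxb.mul d.rx) ?_
  have h1 := d.x_mixed (Nat.succ_pos r)
  have hq : d.e - d.c ⟨0, Nat.succ_pos r⟩ * d.e * d.c ⟨0, Nat.succ_pos r⟩ ∈ d.wf.F 0 :=
    sub_mem d.e_mem (d.F0m (d.F0m (d.c_mem _) d.e_mem) (d.c_mem _))
  generalize d.c ⟨0, Nat.succ_pos r⟩ * d.e * d.c ⟨0, Nat.succ_pos r⟩ = y at h1 hq
  have h2 : d.xb1 * d.x1 - d.x1 * d.xb1 = d.x1 * (d.e - y) - (d.e - y) * d.x1 := by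
    have h3 : d.x1 * (d.e - y) + d.x1 * d.xb1 = (d.e - y) * d.x1 + d.xb1 * d.x1 := by
      rw [← mul_add, ← add_mul, ← h1]; congr 1; abel
    rw [sub_eq_sub_iff_add_eq_add, add_comm, ← h3, ]
  rw [h2]
  exact sub_mem (d.F10 d.x1_mem hq) (d.F01 hq d.x1_mem)

theorem g_e_xpow {ω : ℕ → R} (hs : d.IsSpec ω) (k : ℕ) : d.gw.e * d.gx1 ^ k * d.gw.e = 0 := by
  rcases Nat.eq_zero_or_pos k with h | h
  · subst h; rw [pow_zero, mul_one]; exact d.gw.e_sq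
  have h1 := ((d.re.mul (d.rx.pow1 k)).mul d.re).cast (m := k) (by omega)
  refine h1.uniq (Filt.Rep.zero_of ?_)
  rcases Nat.even_or_odd' k with ⟨l, rfl | rfl⟩
  · rw [d.e_xeven l (by omega)]; exact zero_mem _
  · rw [d.e_xodd l, hs.1, ← Algebra.smul_def]
    exact Submodule.smul_mem _ _ (d.wf.mono (Nat.zero_le _) d.e_mem)

/-- the data on the associated graded algebra -/
def gG {ω : ℕ → R} (hs : d.IsSpec ω) : GData R d.wf.gr r t where
  toWBC := d.gw
  x1 := d.gx1
  xb1 := d.gxb1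
  x_comm := d.g_x_comm
  x1_c1 := (d.rx.mul (d.rc _)).eq' (((d.rc _).mul d.rx).neg) (d.x1_c1 _)
  x1_c i hi := (d.rx.mul (d.rc _)).eq' (((d.rc _).mul d.rx))
    (d.x1_c i (fun h => hi (Fin.ext h)))
  s_x1 i h h' := ((d.rσ _).mul d.rx).eq' (d.rx.mul (d.rσ _)) (d.s_x1 i h h')
  xb_comm := d.g_xb_comm
  xb1_cb1 := (d.rxb.mul (d.rcb _)).eq' (((d.rcb _).mul d.rxb).neg) (d.xb1_cb1 _)
  xb1_cb i hi := (d.rxb.mul (d.rcb _)).eq' (((d.rcb _).mul d.rxb))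
    (d.xb1_cb i (fun h => hi (Fin.ext h)))
  sb_xb1 i h h' := ((d.rσb _).mul d.rxb).eq' (d.rxb.mul (d.rσb _)) (d.sb_xb1 i h h')
  e_xsum := (d.re.mul (d.rx.add d.rxb)).eq' (Filt.Rep.zero_of (zero_mem _)) d.e_xsum
  xsum_e := ((d.rx.add d.rxb).mul d.re).eq' (Filt.Rep.zero_of (zero_mem _)) d.xsum_e
  e_sxs h := (d.re.mul (d.rsxs _ _)).eq' ((d.rsxs _ _).mul d.re) (d.e_sxs h)
  x_xb := d.g_x_xb
  e_sbxbsb h := (d.re.mul (d.rsbxs _ _)).eq' ((d.rsbxs _ _).mul d.re) (d.e_sbxbsb h)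
  e_xpow := d.g_e_xpow hs
  x1_cb_comm j := (d.rx.mul (d.rcb _)).eq' (((d.rcb _).mul d.rx)) (d.x1_cb_comm j)
  xb1_c_comm j := (d.rxb.mul (d.rc _)).eq' (((d.rc _).mul d.rxb)) (d.xb1_c_comm j)
  x1_σb j := ((d.rσb _).mul d.rx).eq' (d.rx.mul (d.rσb _)) (d.x1_σb j)
  xb1_σ j := ((d.rσ _).mul d.rxb).eq' (d.rxb.mul (d.rσ _)) (d.xb1_σ j)

variable {ω : ℕ → R} (hs : d.IsSpec ω)

theorem word_K (h2 : IsUnit (2 : R)) {n : ℕ} {a : A} (h : IsWord d n a) :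
    ∃ z ∈ (d.gG hs).K, d.wf.Rep n a z := by
  induction h with
  | one => exact ⟨1, GData.K_one _, Filt.Rep.one⟩
  | σ w _ ih =>
    obtain ⟨z, hz, hr⟩ := ih
    refine ⟨_, (d.gG hs).K_ρ (w, 1) hz, ?_⟩
    rw [GData.ρ_inl]
    exact ((d.rσ w).mul hr).cast (by omega)
  | σb w _ ih =>
    obtain ⟨z, hz, hr⟩ := ih
    refine ⟨_, (d.gG hs).K_ρ (1, w) hz, ?_⟩
    rw [GData.ρ_inr]
    exact ((d.rσb w).mul hr).cast (by omega)
  | c i _ ih =>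
    obtain ⟨z, hz, hr⟩ := ih
    exact ⟨_, (d.gG hs).K_inl true i hz, ((d.rc i).mul hr).cast (by omega)⟩
  | cb i _ ih =>
    obtain ⟨z, hz, hr⟩ := ih
    exact ⟨_, (d.gG hs).K_inr true i hz, ((d.rcb i).mul hr).cast (by omega)⟩
  | e _ ih =>
    obtain ⟨z, hz, hr⟩ := ih
    exact ⟨_, (d.gG hs).K_e h2 hz, (d.re.mul hr).cast (by omega)⟩
  | x1 _ ih =>
    obtain ⟨z, hz, hr⟩ := ih
    refine ⟨_, (d.gG hs).K_inl false 0 hz, ?_⟩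
    rw [GData.Lt, cj_zero]
    exact (d.rx.mul hr).cast (by omega)
  | xb1 _ ih =>
    obtain ⟨z, hz, hr⟩ := ih
    refine ⟨_, (d.gG hs).K_inr false 0 hz, ?_⟩
    rw [GData.Lt, cj_zero]
    exact (d.rxb.mul hr).cast (by omega)

theorem F_le (h2 : IsUnit (2 : R)) {ι : Type} (m : ι → A) (deg : ι → ℕ) (z : ι → d.wf.gr)
    (hm : ∀ i, d.wf.Rep (deg i) (m i) (z i))
    (hK : (d.gG hs).K ≤ Submodule.span R (Set.range z)) (n : ℕ) :
    d.wf.F n ≤ Submodule.span R (Set.range m) := by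
  induction n using Nat.strong_induction_on with
  | _ n IH =>
  rw [wf_F, Submodule.span_le]
  rintro a ⟨k, hk, ha⟩
  obtain ⟨y, hy, hr⟩ := d.word_K hs h2 ha
  have := Filt.extract m deg z hm hr (hK hy)
  have h3 : d.wf.Fl k ≤ Submodule.span R (Set.range m) := ?_
  · exact (sup_le le_rfl h3 : Submodule.span R (Set.range m) ⊔ d.wf.Fl k ≤ _) this
  cases k with
  | zero => exact bot_le
  | succ k => exact IH k (by omega)

theorem span_top (h2 : IsUnit (2 : R)) {ι : Type} (m : ι → A) (deg : ι → ℕ) (z : ι → d.wf.gr)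
    (hm : ∀ i, d.wf.Rep (deg i) (m i) (z i))
    (hK : (d.gG hs).K ≤ Submodule.span R (Set.range z)) (hall : ∀ a, a ∈ d.US) :
    Submodule.span R (Set.range m) = ⊤ := by
  rw [eq_top_iff]
  intro a _
  obtain ⟨n, hn⟩ := hall a
  exact d.F_le hs h2 m deg z hm hK n hn

end AWBC
end words

/-! ### Leading terms of the regular monomials -/

section leading

/-- `s_n ⋯ s_1` -/
def pdn (N n : ℕ) : Equiv.Perm (Fin N) :=
  ((List.range n).reverse.map (fun k => sw N (k + 1 - 1) (k + 1))).prod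
/-- `s_1 ⋯ s_n` -/
def pup (N n : ℕ) : Equiv.Perm (Fin N) :=
  ((List.range n).map (fun k => sw N (k + 1 - 1) (k + 1))).prod

theorem pdn_succ (N n : ℕ) : pdn N (n + 1) = sw N n (n + 1) * pdn N n := by
  simp [pdn, List.range_succ]
theorem pup_succ (N n : ℕ) : pup N (n + 1) = pup N n * sw N n (n + 1) := by
  simp [pup, List.range_succ]

theorem sw_sq (N a b : ℕ) : sw N a b * sw N a b = 1 := by
  rw [sw]; split_ifs <;> simp

theorem pdn_pup (N n : ℕ) : pdn N n * pup N n = 1 := by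
  induction n with
  | zero => simp [pdn, pup]
  | succ n ih => rw [pdn_succ, pup_succ, mul_assoc, ← mul_assoc (pdn N n), ih, one_mul, sw_sq]

theorem pdn_zero (N n : ℕ) (hn : n < N + 1) : pdn (N + 1) n 0 = ⟨n, hn⟩ := by
  induction n with
  | zero => simp [pdn]
  | succ n ih =>
    rw [pdn_succ, Equiv.Perm.mul_apply, ih (by omega), sw_eq _ _ (by omega) hn,
      Equiv.swap_apply_left]

theorem cj_pq {B : Type} [Ring B] {n : ℕ} (σ : Equiv.Perm (Fin (n + 1)) →* B) (y : B)
    (h : ∀ w : Equiv.Perm (Fin (n + 1)), w 0 = 0 → σ w * y = y * σ w)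
    (i : Fin (n + 1)) : σ (pdn (n + 1) i) * y * σ (pup (n + 1) i) = cj σ y i := by
  rw [cj_of σ y h, mul_assoc, ← map_mul, pdn_pup, map_one, mul_one, pdn_zero n i i.2]

namespace AWBC
variable {R A : Type} [CommRing R] [Ring A] [Algebra R A] {r t : ℕ} {ω1 : R}
  (d : AWBC R A (r + 1) (t + 1) ω1) {ω : ℕ → R} (hs : d.IsSpec ω)

theorem cn_mem (i) : d.cn i ∈ d.wf.F 0 := by
  rw [WBC.cn]; split_ifs
  · exact d.c_mem _
  · exact zero_mem _
theorem cbn_mem (i) : d.cbn i ∈ d.wf.F 0 := by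
  rw [WBC.cbn]; split_ifs
  · exact d.cb_mem _
  · exact zero_mem _

theorem L_mem (i) : d.toWBC.L i ∈ d.wf.F 0 := by
  have h : d.toWBC.LL i ∈ d.wf.F 0 := Submodule.sum_mem _ (fun j _ => d.σ_mem _)
  exact add_mem h (d.F0m (d.F0m (d.cn_mem _) h) (d.cn_mem _))
theorem Lb_mem (i) : d.toWBC.Lb i ∈ d.wf.F 0 := by
  have h : d.toWBC.LLb i ∈ d.wf.F 0 := Submodule.sum_mem _ (fun j _ => d.σb_mem _)
  exact sub_mem h (d.F0m (d.F0m (d.cbn_mem _) h) (d.cbn_mem _))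

theorem xp_eq (i : ℕ) : d.xp (i + 1) = d.σ (pdn (r + 1) i) * d.x1 * d.σ (pup (r + 1) i) := by
  rw [xp, pdn, pup, map_list_prod, map_list_prod, List.map_map, List.map_map]; rfl
theorem xbp_eq (i : ℕ) : d.xbp (i + 1) = d.σb (pdn (t + 1) i) * d.xb1 * d.σb (pup (t + 1) i) := by
  rw [xbp, pdn, pup, map_list_prod, map_list_prod, List.map_map, List.map_map]; rfl

theorem rxv (i : Fin (r + 1)) :
    d.wf.Rep 1 (d.xv ((i : ℕ) + 1)) ((d.gG hs).Lt false (.inl i)) := by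
  have h1 := d.rsxs (pdn (r + 1) i) (pup (r + 1) i)
  have h2 := cj_pq (d.gG hs).σ (d.gG hs).x1 (d.gG hs).x1_stab i
  have h3 : d.wf.Rep 1 (d.σ (pdn (r + 1) i) * d.x1 * d.σ (pup (r + 1) i))
    ((d.gG hs).Lt false (.inl i)) := by
    rw [GData.Lt, ← h2]; exact h1
  refine h3.congr ?_
  rw [xv, xp_eq, sub_sub_cancel_left]
  exact neg_mem (d.L_mem _)

theorem rxbv (i : Fin (t + 1)) :
    d.wf.Rep 1 (d.xbv ((i : ℕ) + 1)) ((d.gG hs).Lt false (.inr i)) := by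
  have h1 := d.rsbxs (pdn (t + 1) i) (pup (t + 1) i)
  have h2 := cj_pq (d.gG hs).σb (d.gG hs).xb1 (d.gG hs).xb1_stab i
  have h3 : d.wf.Rep 1 (d.σb (pdn (t + 1) i) * d.xb1 * d.σb (pup (t + 1) i))
    ((d.gG hs).Lt false (.inr i)) := by
    rw [GData.Lt, ← h2]; exact h1
  refine h3.congr ?_
  rw [xbv, xbp_eq, sub_sub_cancel_left]
  exact neg_mem (d.Lb_mem _)

/-- the degree of a regular monomial -/
def sdeg (s : SIndex (r + 1) (t + 1)) : ℕ :=
  ((List.finRange (r + 1)).map s.α).sum + ((List.finRange (t + 1)).map s.β).sum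

theorem rsreg (s : SIndex (r + 1) (t + 1)) :
    d.wf.Rep (sdeg s) (d.sregElt s) ((d.gG hs).gmon s) := by
  have h1 := Filt.Rep.list (Φ := d.wf) (List.finRange (r + 1)) s.α _ _
    (fun i => (d.rxv hs i).pow1 (s.α i))
  have h2 := Filt.Rep.list (Φ := d.wf) (List.finRange (t + 1)) s.β _ _
    (fun i => (d.rxbv hs i).pow1 (s.β i))
  exact ((h1.mul (d.rbas s.dIdx)).mul h2).cast (by rw [sdeg]; omega)

theorem spec_span {ω : ℕ → R} (hs : d.IsSpec ω) (h2 : IsUnit (2 : R)) (hall : ∀ a, a ∈ d.US) :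
    Submodule.span R (Set.range (fun x : SIndex (r + 1) (t + 1) => d.sregElt x)) = ⊤ :=
  d.span_top hs h2 _ sdeg (d.gG hs).gmon (d.rsreg hs) (GData.K_le _) hall

theorem pow_zero_of {ℓ : ℕ} {f : Polynomial R} (hf : f.Monic) (hd : f.natDegree = ℓ + 1) {a : A}
    {z : d.wf.gr} (h : d.wf.Rep 1 a z) (h0 : Polynomial.aeval a f = 0) : z ^ (ℓ + 1) = 0 := by
  refine (h.pow1 (ℓ + 1)).uniq (Filt.Rep.zero_of ?_)
  have h1 := hf.as_sum
  rw [h1, map_add, map_sum, map_pow, Polynomial.aeval_X, hd] at h0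
  rw [eq_neg_of_add_eq_zero_left h0]
  refine neg_mem (Submodule.sum_mem _ (fun i hi => ?_))
  rw [map_mul, map_pow, Polynomial.aeval_X, Polynomial.aeval_C, ← Algebra.smul_def]
  refine Submodule.smul_mem _ _ ?_
  obtain ⟨hm, -⟩ := h.pow1 i
  exact d.wf.mono (by have := Finset.mem_range.1 hi; omega) hm

end AWBC

namespace GData
variable {R B : Type} [CommRing R] [Ring B] [Algebra R B] {r t : ℕ} (d : GData R B r t)

theorem Lt_pow_inl {n : ℕ} (h : d.x1 ^ n = 0) (i) : d.Lt false (.inl i) ^ n = 0 := by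
  have h1 := (d.semi_Lt (Equiv.swap 0 i, 1) false (.inl 0)).pow_right n
  have h2 : d.Lt false (.inl 0) ^ n = 0 := by rw [Lt, cj_zero, h]
  simpa using (d.semi_eq _ h1 (SemiconjBy.zero_right _) h2)

theorem Lt_pow_inr {n : ℕ} (h : d.xb1 ^ n = 0) (i) : d.Lt false (.inr i) ^ n = 0 := by
  have h1 := (d.semi_Lt (1, Equiv.swap 0 i) false (.inr 0)).pow_right n
  have h2 : d.Lt false (.inr 0) ^ n = 0 := by rw [Lt, cj_zero, h]
  simpa using (d.semi_eq _ h1 (SemiconjBy.zero_right _) h2)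

/-- forget the bound on the exponents -/
def toS {ℓ : ℕ} (s : CIndex (r + 1) (t + 1) ℓ) : SIndex (r + 1) (t + 1) :=
  ⟨fun i => s.α i, fun i => s.β i, s.dIdx⟩

theorem K_le_cyc {ℓ : ℕ} (h : d.x1 ^ ℓ = 0) (hb : d.xb1 ^ ℓ = 0) :
    d.K ≤ Submodule.span R (Set.range (fun s : CIndex (r + 1) (t + 1) ℓ => d.gmon (toS s))) := by
  refine d.K_le.trans (Submodule.span_le.2 ?_)
  rintro _ ⟨s, rfl⟩
  by_cases h1 : ∀ i, s.α i < ℓ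
  · by_cases h2 : ∀ i, s.β i < ℓ
    · exact Submodule.subset_span ⟨⟨fun i => ⟨s.α i, h1 i⟩, fun i => ⟨s.β i, h2 i⟩, s.dIdx⟩, rfl⟩
    · push Not at h2
      obtain ⟨i, hi⟩ := h2
      have : d.gxb s.β = 0 := by
        refine List.prod_eq_zero (List.mem_map.2 ⟨i, List.mem_finRange i, ?_⟩)
        exact pow_eq_zero_of_le hi (d.Lt_pow_inr hb i)
      rw [gmon, this, mul_zero]; exact zero_mem _
  · push Not at h1
    obtain ⟨i, hi⟩ := h1
    have : d.gx s.α = 0 := by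
      refine List.prod_eq_zero (List.mem_map.2 ⟨i, List.mem_finRange i, ?_⟩)
      exact pow_eq_zero_of_le hi (d.Lt_pow_inl h i)
    rw [gmon, this, zero_mul, zero_mul]; exact zero_mem _

end GData

namespace AWBC
variable {R A : Type} [CommRing R] [Ring A] [Algebra R A] {r t : ℕ} {ω1 : R}
  (d : AWBC R A (r + 1) (t + 1) ω1) {ω : ℕ → R} (hs : d.IsSpec ω)

theorem cyc_span {ω : ℕ → R} (hs : d.IsSpec ω) (h2 : IsUnit (2 : R)) (hall : ∀ a, a ∈ d.US) {ℓ : ℕ} {f g : Polynomial R}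
    (hf : f.Monic) (hfd : f.natDegree = ℓ) (hg : g.Monic) (hgd : g.natDegree = ℓ)
    (hc : d.IsCyc f g) :
    Submodule.span R (Set.range (fun x : CIndex (r + 1) (t + 1) ℓ => d.cregElt x)) = ⊤ := by
  cases ℓ with
  | zero =>
    have h1 : f = 1 := hf.natDegree_eq_zero.1 hfd
    have h3 := hc.1
    rw [h1, map_one] at h3
    rw [eq_top_iff]
    intro a _
    rw [← mul_one a, h3, mul_zero]
    exact zero_mem _
  | succ ℓ =>
    exact d.span_top hs h2 _ (fun s => sdeg (GData.toS s)) _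
      (fun s => d.rsreg hs (GData.toS s))
      ((d.gG hs).K_le_cyc (d.pow_zero_of hf hfd d.rx hc.1) (d.pow_zero_of hg hgd d.rxb hc.2)) hall

end AWBC

theorem poly_deg {R : Type} [CommRing R] [Nontrivial R] (k m : ℕ) (u : Fin m → R) :
    (Polynomial.X ^ k * ∏ i, (Polynomial.X ^ 2 - Polynomial.C (u i ^ 2)) : Polynomial R).Monic ∧
    (Polynomial.X ^ k * ∏ i, (Polynomial.X ^ 2 - Polynomial.C (u i ^ 2)) :
      Polynomial R).natDegree = k + 2 * m := by
  have h1 : ∀ i ∈ (Finset.univ : Finset (Fin m)),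
      (Polynomial.X ^ 2 - Polynomial.C (u i ^ 2) : Polynomial R).Monic :=
    fun i _ => Polynomial.monic_X_pow_sub_C _ (by norm_num)
  have h2 := Polynomial.monic_prod_of_monic _ _ h1
  refine ⟨(Polynomial.monic_X_pow k).mul h2, ?_⟩
  rw [(Polynomial.monic_X_pow k).natDegree_mul h2, Polynomial.natDegree_prod_of_monic _ _ h1,
    Polynomial.natDegree_X_pow,
    Finset.sum_congr rfl (fun i _ => Polynomial.natDegree_X_pow_sub_C (n := 2) (r := u i ^ 2))]
  simp [mul_comm]

end leading

/-- Corollary 3.16: as `R`-modules, `B̃C_{r,t}` and the cyclotomic quotient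
`BC_{ℓ,r,t}` are spanned by their regular monomials `x^α d x̄^β` (with exponents in `ℕ`,
resp. in `{0, …, ℓ-1}`). -/
theorem statement10 (R A₀ A₁ : Type) [CommRing R] [IsDomain R]
    [Ring A₀] [Algebra R A₀] [Ring A₁] [Algebra R A₁]
    (h2 : IsUnit (2 : R)) (r t : ℕ) (hr : 1 ≤ r) (ht : 1 ≤ t)
    (ω : ℕ → R) (hωe : ∀ n, ω (2 * n) = 0)
    (k m k1 m1 : ℕ) (u : Fin m → R) (ub : Fin m1 → R)
    (hu0 : ∀ i, u i ≠ 0) (hub0 : ∀ j, ub j ≠ 0)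
    (f g : Polynomial R)
    (hf : f = Polynomial.X ^ k * ∏ i, (Polynomial.X ^ 2 - Polynomial.C (u i ^ 2)))
    (hg : g = Polynomial.X ^ k1 * ∏ j, (Polynomial.X ^ 2 - Polynomial.C (ub j ^ 2)))
    (hdeg : k + 2 * m = k1 + 2 * m1)
    (d₀ : AWBC R A₀ r t (ω 1)) (hu₀ : d₀.IsSpecUniversal ω)
    (hcomp : d₀.e * Polynomial.aeval d₀.x1 f
      = (-1 : A₀) ^ k * (d₀.e * Polynomial.aeval d₀.xb1 g))
    (d₁ : AWBC R A₁ r t (ω 1)) (hu₁ : d₁.IsCycUniversal ω f g) :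
    Submodule.span R (Set.range (fun x : SIndex r t => d₀.sregElt x)) = ⊤ ∧
    Submodule.span R (Set.range (fun x : CIndex r t (k + 2 * m) => d₁.cregElt x)) = ⊤ := by
  obtain ⟨r, rfl⟩ : ∃ r', r = r' + 1 := ⟨r - 1, by omega⟩
  obtain ⟨t, rfl⟩ : ∃ t', t = t' + 1 := ⟨t - 1, by omega⟩
  constructor
  · obtain ⟨hs, hu⟩ := hu₀
    have hin := d₀.inUS hs
    exact d₀.spec_span hs h2 (d₀.all_mem d₀.US hin
      (hu _ _ (d₀.restrict_spec d₀.US hin hs)).exists (hu _ d₀ hs))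
  · obtain ⟨hs, hc, hu⟩ := hu₁
    have hin := d₁.inUS hs
    obtain ⟨hf1, hf2⟩ := poly_deg k m u
    obtain ⟨hg1, hg2⟩ := poly_deg k1 m1 ub
    rw [← hf] at hf1 hf2
    rw [← hg] at hg1 hg2
    exact d₁.cyc_span hs h2 (d₁.all_mem d₁.US hin
      (hu _ _ (d₁.restrict_spec d₁.US hin hs) (d₁.restrict_cyc d₁.US hin hc)).exists
      (hu _ d₁ hs hc)) hf1 hf2 hg1 (hg2.trans hdeg.symm) hc
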